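/- Let G be a finite abelian group, n ≥ exp(G), and let S be a finite sequence over G with |S| = |G| + n and h(S) ≤ n. Suppose that for every proper subgroup H < G and every α ∈ G, at least |G/H| − 1 terms of S lie outside the coset α + H. Then Σ_{|G|}(S) = G. -/

import Mathlib

/-- The set of `n`-term subsequence sums of the finite sequence (multiset) `S`. -/
def subseqSums {G : Type*} [AddCommGroup G] (S : Multiset G) (n : ℕ) : Set G :=
  {x | ∃ T ≤ S, Multiset.card T = n ∧ T.sum = x}

section
open scoped Pointwise Classical

/-- The stabilizer of a subset of an abelian group under translation. -/
def setStab {G : Type*} [AddCommGroup G] (A : Set G) : AddSubgroup G where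
  carrier := {g | ∀ x, g + x ∈ A ↔ x ∈ A}
  zero_mem' := by simp
  add_mem' := by
    intro a b ha hb x
    rw [add_assoc, ha, hb]
  neg_mem' := by
    intro a ha x
    rw [← ha, add_neg_cancel_left]

variable {G : Type*} [AddCommGroup G]

theorem mem_setStab {A : Set G} {g : G} : g ∈ setStab A ↔ ∀ x, g + x ∈ A ↔ x ∈ A := Iff.rfl

theorem le_setStab_of_forall {A : Set G} {K : AddSubgroup G}
    (h : ∀ g ∈ K, ∀ x ∈ A, g + x ∈ A) : K ≤ setStab A := by
  intro g hg x
  refine ⟨fun hx => ?_, h g hg x⟩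
  have := h (-g) (K.neg_mem hg) _ hx
  rwa [neg_add_cancel_left] at this

theorem le_setStab_iff {A : Set G} {K : AddSubgroup G} :
    K ≤ setStab A ↔ A + (K : Set G) = A := by
  constructor
  · intro h
    ext x
    constructor
    · rintro ⟨a, ha, k, hk, rfl⟩
      have := (h hk a).2 ha
      rwa [add_comm] at this
    · intro hx
      exact ⟨x, hx, 0, K.zero_mem, add_zero x⟩
  · intro h
    refine le_setStab_of_forall fun g hg x hx => ?_
    rw [← h]
    exact ⟨x, hx, g, hg, add_comm _ _⟩

theorem add_setStab (A : Set G) : A + (setStab A : Set G) = A := le_setStab_iff.1 le_rfl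

theorem subset_add_subgroup (A : Set G) (K : AddSubgroup G) : A ⊆ A + (K : Set G) :=
  fun x hx => ⟨x, hx, 0, K.zero_mem, add_zero x⟩

theorem subgroup_add_self (K : AddSubgroup G) : (K : Set G) + (K : Set G) = K := by
  ext x
  constructor
  · rintro ⟨a, ha, k, hk, rfl⟩
    exact K.add_mem ha hk
  · intro hx
    exact ⟨x, hx, 0, K.zero_mem, add_zero x⟩

theorem le_setStab_add_subgroup (A : Set G) (K : AddSubgroup G) :
    K ≤ setStab (A + (K : Set G)) := by
  rw [le_setStab_iff, add_assoc, subgroup_add_self]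

theorem le_setStab_add_right {A : Set G} {K : AddSubgroup G} (h : K ≤ setStab A) (B : Set G) :
    K ≤ setStab (A + B) := by
  rw [le_setStab_iff] at *
  rw [add_right_comm, h]

theorem le_setStab_add_left {A : Set G} {K : AddSubgroup G} (h : K ≤ setStab A) (B : Set G) :
    K ≤ setStab (B + A) := by
  rw [add_comm]
  exact le_setStab_add_right h B

theorem le_setStab_union {A B : Set G} {K : AddSubgroup G} (hA : K ≤ setStab A)
    (hB : K ≤ setStab B) : K ≤ setStab (A ∪ B) := by
  intro g hg x
  simp only [Set.mem_union, hA hg x, hB hg x]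

theorem le_setStab_inter {A B : Set G} {K : AddSubgroup G} (hA : K ≤ setStab A)
    (hB : K ≤ setStab B) : K ≤ setStab (A ∩ B) := by
  intro g hg x
  simp only [Set.mem_inter_iff, hA hg x, hB hg x]

theorem le_setStab_sdiff {A B : Set G} {K : AddSubgroup G} (hA : K ≤ setStab A)
    (hB : K ≤ setStab B) : K ≤ setStab (A \ B) := by
  intro g hg x
  simp only [Set.mem_sdiff, hA hg x, hB hg x]

theorem setStab_vadd (A : Set G) (a : G) : setStab (a +ᵥ A) = setStab A := by
  have key : ∀ g x, (g + x ∈ a +ᵥ A ↔ g + (x - a) ∈ A) := by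
    intro g x
    have h : -a + (g + x) = g + (x - a) := by abel
    rw [Set.mem_vadd_set_iff_neg_vadd_mem, vadd_eq_add, h]
  ext g
  simp only [mem_setStab]
  constructor
  · intro h x
    have := h (x + a)
    have h2 := key 0 (x + a)
    rw [key] at this
    simpa [h2] using this.trans (by simpa using h2)
  · intro h x
    rw [key, h]
    have h2 := key 0 x
    simpa using h2.symm

theorem le_setStab_subgroup {K H : AddSubgroup G} (h : K ≤ H) : K ≤ setStab (H : Set G) :=
  le_setStab_of_forall fun _ hg _ hx => H.add_mem (h hg) hx

theorem le_setStab_coset {K H : AddSubgroup G} (h : K ≤ H) (a : G) :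
    K ≤ setStab (a +ᵥ (H : Set G)) := by
  rw [setStab_vadd]
  exact le_setStab_subgroup h

theorem add_subgroup_subset {A B : Set G} {K : AddSubgroup G} (h : A ⊆ B)
    (hK : K ≤ setStab B) : A + (K : Set G) ⊆ B := by
  rw [← le_setStab_iff.1 hK]
  exact Set.add_subset_add_right h

theorem add_subgroup_mono (A : Set G) {K H : AddSubgroup G} (h : K ≤ H) :
    A + (K : Set G) ⊆ A + (H : Set G) :=
  Set.add_subset_add_left h

theorem add_add_subgroup (A B : Set G) (K : AddSubgroup G) :
    (A + (K : Set G)) + (B + (K : Set G)) = A + B + (K : Set G) := by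
  rw [add_add_add_comm, subgroup_add_self]

theorem mem_coset_iff {K : AddSubgroup G} {a x : G} :
    x ∈ a +ᵥ (K : Set G) ↔ x - a ∈ K := by
  rw [Set.mem_vadd_set_iff_neg_vadd_mem, vadd_eq_add, neg_add_eq_sub]
  rfl

theorem mem_add_subgroup {A : Set G} {K : AddSubgroup G} {x : G} :
    x ∈ A + (K : Set G) ↔ ∃ a ∈ A, x - a ∈ K := by
  constructor
  · rintro ⟨a, ha, k, hk, rfl⟩
    exact ⟨a, ha, by simpa using hk⟩
  · rintro ⟨a, ha, h⟩
    exact ⟨a, ha, x - a, h, add_sub_cancel a x⟩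

theorem mem_of_sub_mem {A : Set G} {K : AddSubgroup G} (h : K ≤ setStab A) {x y : G}
    (hy : y ∈ A) (hxy : x - y ∈ K) : x ∈ A := by
  have := (h hxy y).2 hy
  rwa [sub_add_cancel] at this

theorem coset_subset {A : Set G} {K : AddSubgroup G} (h : K ≤ setStab A) {x : G}
    (hx : x ∈ A) : x +ᵥ (K : Set G) ⊆ A :=
  fun _ hy => mem_of_sub_mem h hx (mem_coset_iff.1 hy)

theorem ncard_coset (K : AddSubgroup G) (a : G) : (a +ᵥ (K : Set G)).ncard = Nat.card K := by
  rw [Set.ncard_vadd_set]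
  exact (Nat.card_coe_set_eq _).symm

theorem coset_eq_coset {K : AddSubgroup G} {a b : G} (h : a - b ∈ K) :
    a +ᵥ (K : Set G) = b +ᵥ (K : Set G) := by
  ext x
  rw [mem_coset_iff, mem_coset_iff]
  constructor
  · intro hx
    simpa using K.add_mem hx h
  · intro hx
    simpa using K.sub_mem hx h

theorem disjoint_coset {K : AddSubgroup G} {a b : G} (h : a - b ∉ K) :
    Disjoint (a +ᵥ (K : Set G)) (b +ᵥ (K : Set G)) := by
  rw [Set.disjoint_left]
  intro x hx hx'
  rw [mem_coset_iff] at hx hx'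
  apply h
  simpa using K.sub_mem hx' hx

theorem card_dvd_ncard [Finite G] {A : Set G} {K : AddSubgroup G} (h : K ≤ setStab A) :
    Nat.card K ∣ A.ncard := by
  have h1 : A = (QuotientAddGroup.mk : G → G ⧸ K) ⁻¹' ((QuotientAddGroup.mk : G → G ⧸ K) '' A) := by
    ext x
    constructor
    · intro hx; exact ⟨x, hx, rfl⟩
    · rintro ⟨y, hy, hxy⟩
      rw [QuotientAddGroup.eq] at hxy
      exact mem_of_sub_mem h hy (by rwa [sub_eq_neg_add])
  rw [h1, ← Nat.card_coe_set_eq, Nat.card_congr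
    (QuotientAddGroup.preimageMkEquivAddSubgroupProdSet K _), Nat.card_prod]
  exact dvd_mul_right _ _

end

section
open scoped Pointwise Classical

variable {G : Type*} [AddCommGroup G]

theorem vadd_subgroup_add_vadd_subgroup (K : AddSubgroup G) (a b : G) :
    (a +ᵥ (K : Set G)) + (b +ᵥ (K : Set G)) = (a + b) +ᵥ (K : Set G) := by
  rw [← Set.singleton_vadd, ← Set.singleton_vadd, ← Set.singleton_vadd, vadd_eq_add, vadd_eq_add,
    vadd_eq_add, add_add_add_comm, subgroup_add_self, Set.singleton_add_singleton]

theorem ncard_union_add_subgroup_le (A B : Set G) (K : AddSubgroup G) :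
    ((A ∪ B) + (K : Set G)).ncard ≤ (A + (K : Set G)).ncard + (B + (K : Set G)).ncard := by
  rw [Set.union_add]
  exact Set.ncard_union_le _ _

theorem setStab_le_of_subset_coset {E : Set G} {K : AddSubgroup G} {c : G} (hE : E.Nonempty)
    (h : E ⊆ c +ᵥ (K : Set G)) : setStab E ≤ K := by
  intro g hg
  obtain ⟨x, hx⟩ := hE
  have h1 := mem_coset_iff.1 (h hx)
  have h2 := mem_coset_iff.1 (h ((hg x).2 hx))
  have := K.sub_mem h2 h1
  simpa using this

variable [Finite G]

theorem ncard_add_subgroup_le_of_subset_coset {A : Set G} {K K' : AddSubgroup G} {a : G}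
    (hA : A ⊆ a +ᵥ (K : Set G)) (hK : K' ≤ K) : (A + (K' : Set G)).ncard ≤ Nat.card K := by
  rw [← ncard_coset K a]
  exact Set.ncard_le_ncard (add_subgroup_subset hA (le_setStab_coset hK a))

theorem ncard_add_subgroup_mono (A : Set G) {K H : AddSubgroup G} (h : K ≤ H) :
    (A + (K : Set G)).ncard ≤ (A + (H : Set G)).ncard :=
  Set.ncard_le_ncard (add_subgroup_mono A h)

theorem ncard_hole {U : Set G} {K K' : AddSubgroup G} (hK : K' ≤ K) {a : G} (ha : a ∈ U) :
    (U + (K' : Set G)).ncard + Nat.card K ≤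
      (U + (K : Set G)).ncard + (U ∩ (a +ᵥ (K : Set G)) + (K' : Set G)).ncard := by
  have hsub : a +ᵥ (K : Set G) ⊆ U + (K : Set G) :=
    coset_subset (le_setStab_add_subgroup U K) (subset_add_subgroup U K ha)
  have h1 : U + (K' : Set G) ⊆ ((U + (K : Set G)) \ (a +ᵥ (K : Set G))) ∪
      (U ∩ (a +ᵥ (K : Set G)) + (K' : Set G)) := by
    intro x hx
    by_cases hxa : x ∈ a +ᵥ (K : Set G)
    · right
      obtain ⟨u, hu, hxu⟩ := mem_add_subgroup.1 hx
      refine mem_add_subgroup.2 ⟨u, ⟨hu, ?_⟩, hxu⟩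
      rw [mem_coset_iff] at hxa ⊢
      have := K.sub_mem hxa (hK hxu)
      rwa [sub_sub_sub_cancel_left] at this
    · exact Or.inl ⟨add_subgroup_mono U hK hx, hxa⟩
  have h2 := (Set.ncard_le_ncard h1).trans (Set.ncard_union_le _ _)
  have h3 := Set.ncard_sdiff_add_ncard_of_subset hsub
  rw [ncard_coset] at h3
  omega

theorem ncard_two_holes {U : Set G} {K K' : AddSubgroup G} (hK : K' ≤ K) {a b : G} (ha : a ∈ U)
    (hb : b ∈ U) (hab : a - b ∉ K) :
    (U + (K' : Set G)).ncard + 2 * Nat.card K ≤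
      (U + (K : Set G)).ncard + (U ∩ (a +ᵥ (K : Set G)) + (K' : Set G)).ncard +
        (U ∩ (b +ᵥ (K : Set G)) + (K' : Set G)).ncard := by
  have hsub : (a +ᵥ (K : Set G)) ∪ (b +ᵥ (K : Set G)) ⊆ U + (K : Set G) :=
    Set.union_subset
      (coset_subset (le_setStab_add_subgroup U K) (subset_add_subgroup U K ha))
      (coset_subset (le_setStab_add_subgroup U K) (subset_add_subgroup U K hb))
  have key : ∀ c x : G, x ∈ U + (K' : Set G) → x ∈ c +ᵥ (K : Set G) →
      x ∈ U ∩ (c +ᵥ (K : Set G)) + (K' : Set G) := by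
    intro c x hx hxa
    obtain ⟨u, hu, hxu⟩ := mem_add_subgroup.1 hx
    refine mem_add_subgroup.2 ⟨u, ⟨hu, ?_⟩, hxu⟩
    rw [mem_coset_iff] at hxa ⊢
    have := K.sub_mem hxa (hK hxu)
    rwa [sub_sub_sub_cancel_left] at this
  have h1 : U + (K' : Set G) ⊆
      ((U + (K : Set G)) \ ((a +ᵥ (K : Set G)) ∪ (b +ᵥ (K : Set G)))) ∪
      ((U ∩ (a +ᵥ (K : Set G)) + (K' : Set G)) ∪ (U ∩ (b +ᵥ (K : Set G)) + (K' : Set G))) := by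
    intro x hx
    by_cases hxa : x ∈ a +ᵥ (K : Set G)
    · exact Or.inr (Or.inl (key a x hx hxa))
    by_cases hxb : x ∈ b +ᵥ (K : Set G)
    · exact Or.inr (Or.inr (key b x hx hxb))
    · exact Or.inl ⟨add_subgroup_mono U hK hx, by simp [hxa, hxb]⟩
  have h2 := (Set.ncard_le_ncard h1).trans (Set.ncard_union_le _ _)
  have h2' := Set.ncard_union_le (U ∩ (a +ᵥ (K : Set G)) + (K' : Set G))
    (U ∩ (b +ᵥ (K : Set G)) + (K' : Set G))
  have h3 := Set.ncard_sdiff_add_ncard_of_subset hsub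
  rw [Set.ncard_union_eq (disjoint_coset hab), ncard_coset, ncard_coset] at h3
  omega

theorem kneser_numeric {K K₁ K₂ : AddSubgroup G} {X W X' W' E₁ E₂ : Set G} {a b : G}
    (hX : X ∪ X' ⊆ a +ᵥ (K : Set G)) (hW : W ∪ W' ⊆ b +ᵥ (K : Set G))
    (hK₁ : K₁ ≤ K) (hE₁ : K₁ ≤ setStab E₁) 
    (h₁ : (X + (K₁ : Set G)).ncard + (W + (K₁ : Set G)).ncard ≤ E₁.ncard + Nat.card K₁)
    (h₂ : (W' + (K₂ : Set G)).ncard + (X' + (K₂ : Set G)).ncard ≤ E₂.ncard + Nat.card K₂)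
    (n₁ : E₁.ncard + Nat.card K₁ + Nat.card K <
      (X ∪ X' + (K₁ : Set G)).ncard + (W ∪ W' + (K₁ : Set G)).ncard)
    (n₃ : (E₁ ∪ E₂).ncard + Nat.card ↥(K₁ ⊓ K₂) + Nat.card K <
      (X ∪ X' + (↑(K₁ ⊓ K₂) : Set G)).ncard + (W ∪ W' + (↑(K₁ ⊓ K₂) : Set G)).ncard)
    (hle : Nat.card K₂ ≤ Nat.card K₁) : False := by
  have i1 := ncard_add_subgroup_le_of_subset_coset hX hK₁
  have i2 := ncard_add_subgroup_le_of_subset_coset hW hK₁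
  have d1 := card_dvd_ncard hE₁
  have d2 : Nat.card K₁ ∣ Nat.card K := AddSubgroup.card_dvd_of_le hK₁
  have i3 : E₁.ncard + 2 * Nat.card K₁ ≤ Nat.card K := by
    obtain ⟨u, hu⟩ := d1
    obtain ⟨v, hv⟩ := d2
    have hlt : E₁.ncard + Nat.card K₁ < Nat.card K := by omega
    rw [hu, hv] at hlt ⊢
    have : u + 1 < v := by
      by_contra hc
      have := Nat.mul_le_mul_left (Nat.card K₁) (not_lt.1 hc)
      lia
    have := Nat.mul_le_mul_left (Nat.card K₁) (Nat.succ_le_of_lt this)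
    lia
  have i4 := ncard_union_add_subgroup_le X X' (K₁ ⊓ K₂)
  have i5 := ncard_union_add_subgroup_le W W' (K₁ ⊓ K₂)
  have j1 := ncard_add_subgroup_mono X (inf_le_left : K₁ ⊓ K₂ ≤ K₁)
  have j2 := ncard_add_subgroup_mono W (inf_le_left : K₁ ⊓ K₂ ≤ K₁)
  have j3 := ncard_add_subgroup_mono X' (inf_le_right : K₁ ⊓ K₂ ≤ K₂)
  have j4 := ncard_add_subgroup_mono W' (inf_le_right : K₁ ⊓ K₂ ≤ K₂)
  have j5 := Set.ncard_le_ncard (Set.subset_union_right : E₂ ⊆ E₁ ∪ E₂)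
  omega

/-- The inequality of Kneser's theorem for the pair `(A, B)`. -/
def KneserBound (A B : Set G) : Prop :=
  (A + (setStab (A + B) : Set G)).ncard + (B + (setStab (A + B) : Set G)).ncard ≤
    (A + B).ncard + Nat.card (setStab (A + B))

/-- A convergent for the pair `(A, B)`. -/
def IsConvergent (A B C : Set G) (K : AddSubgroup G) : Prop :=
  C.Nonempty ∧ C ⊆ A + B ∧ K ≤ setStab C ∧ setStab (A + B) ≤ K ∧
    (A ∩ B).ncard + ((A ∪ B) + (K : Set G)).ncard ≤ C.ncard + Nat.card K

theorem not_convergent_ineq {A B C E P : Set G} {K K' : AddSubgroup G}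
    (hC : IsConvergent A B C K) (hK' : K' ≤ K) (hH : setStab (A + B) ≤ K')
    (hE : E ⊆ A + B) (hEK : K' ≤ setStab E) (hEP : E ⊆ P) (hCP : Disjoint C P)
    (hn : ¬ IsConvergent A B (C ∪ E) K') :
    E.ncard + Nat.card K' + ((A ∪ B) + (K : Set G)).ncard <
      Nat.card K + ((A ∪ B) + (K' : Set G)).ncard := by
  obtain ⟨h1, h2, h3, h4, h5⟩ := hC
  by_contra hc
  refine hn ⟨h1.mono Set.subset_union_left, Set.union_subset h2 hE,
    le_setStab_union (hK'.trans h3) hEK, hH, ?_⟩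
  rw [Set.ncard_union_eq (hCP.mono_right hEP)]
  omega

theorem exists_smaller_convergent {A B C : Set G} {K : AddSubgroup G}
    (hA : setStab (A + B) ≤ setStab A)
    (IH : ∀ A' B' : Set G, A'.Nonempty → B'.Nonempty → (A' + B').ncard < (A + B).ncard →
      KneserBound A' B')
    (hC : IsConvergent A B C K) (hK : K ≠ setStab (A + B)) :
    ∃ C' K', IsConvergent A B C' K' ∧ Nat.card K' < Nat.card K := by
  by_contra! hno
  obtain ⟨hC1, hC2, hC3, hC4, hC5⟩ := id hC
  have hKn : ¬ K ≤ setStab (A + B) := fun h => hK (le_antisymm h hC4)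
  have hex : ∃ a ∈ A, ∃ b ∈ B, ∃ k ∈ K, k + (a + b) ∉ A + B := by
    by_contra! hcon
    refine hKn (le_setStab_of_forall ?_)
    rintro k hk _ ⟨a, ha, b, hb, rfl⟩
    exact hcon a ha b hb k hk
  obtain ⟨a, ha, b, hb, k, hk, hkab⟩ := hex
  set P := (a + b) +ᵥ (K : Set G) with hP
  have hkP : k + (a + b) ∈ P := by
    rw [hP, mem_coset_iff]
    simpa using hk
  have hCP : Disjoint C P := by
    rw [Set.disjoint_left]
    intro x hx hxP
    apply hkab
    apply hC2
    refine mem_of_sub_mem hC3 hx ?_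
    rw [hP, mem_coset_iff] at hxP hkP
    have h := K.sub_mem hkP hxP
    rwa [sub_sub_sub_cancel_right] at h
  have stabA : setStab (A + B) ≤ setStab (a +ᵥ (K : Set G)) := le_setStab_coset hC4 a
  have stabB : setStab (A + B) ≤ setStab (b +ᵥ (K : Set G)) := le_setStab_coset hC4 b
  set aK := a +ᵥ (K : Set G) with haK
  set bK := b +ᵥ (K : Set G) with hbK
  have haa : a ∈ aK := by rw [haK, mem_coset_iff]; simp
  have hbb : b ∈ bK := by rw [hbK, mem_coset_iff]; simp
  have hsum : aK + bK = P := vadd_subgroup_add_vadd_subgroup K a b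
  have small : ∀ E : Set G, E ⊆ A + B → E ⊆ P → E.ncard < (A + B).ncard := by
    intro E h1 h2
    have h3 : C ∪ E ⊆ A + B := Set.union_subset hC2 h1
    have h4 := Set.ncard_le_ncard h3
    rw [Set.ncard_union_eq (hCP.mono_right h2)] at h4
    have := (Set.ncard_pos).2 hC1
    omega
  have proper : ∀ E : Set G, E ⊆ A + B → E ⊆ P → E.Nonempty → setStab E < K := by
    intro E h1 h2 h3
    refine lt_of_le_of_ne (setStab_le_of_subset_coset h3 h2) ?_
    intro h4
    obtain ⟨x, hx⟩ := h3
    apply hkab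
    apply h1
    refine mem_of_sub_mem (K := K) h4.ge hx ?_
    have := h2 hx
    rw [hP, mem_coset_iff] at this hkP
    have h := K.sub_mem hkP this
    rwa [sub_sub_sub_cancel_right] at h
  have nonconv : ∀ (E : Set G) (K' : AddSubgroup G), K' < K → ¬ IsConvergent A B (C ∪ E) K' := by
    intro E K' hlt hconv
    have h1 := hno _ _ hconv
    have h2 : Nat.card K' < Nat.card K := by
      rw [← SetLike.coe_sort_coe, ← SetLike.coe_sort_coe, Nat.card_coe_set_eq, Nat.card_coe_set_eq]
      exact Set.ncard_lt_ncard hlt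
    omega
  have E1sub : A ∩ aK + B ∩ bK ⊆ A + B := Set.add_subset_add Set.inter_subset_left
    Set.inter_subset_left
  have E1P : A ∩ aK + B ∩ bK ⊆ P := hsum ▸ Set.add_subset_add Set.inter_subset_right
    Set.inter_subset_right
  have E2sub : A ∩ bK + B ∩ aK ⊆ A + B := Set.add_subset_add Set.inter_subset_left
    Set.inter_subset_left
  have E2P : A ∩ bK + B ∩ aK ⊆ P := by
    rw [← hsum, add_comm aK bK]
    exact Set.add_subset_add Set.inter_subset_right Set.inter_subset_right
  have nX : (A ∩ aK).Nonempty := ⟨a, ha, haa⟩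
  have nW : (B ∩ bK).Nonempty := ⟨b, hb, hbb⟩
  have b1 := IH _ _ nX nW (small _ E1sub E1P)
  have lt1 := proper _ E1sub E1P (nX.add nW)
  have H1 : setStab (A + B) ≤ setStab (A ∩ aK + B ∩ bK) :=
    le_setStab_add_right (le_setStab_inter hA stabA) _
  have c1 := not_convergent_ineq hC lt1.le H1 E1sub le_rfl E1P hCP (nonconv _ _ lt1)
  unfold KneserBound at b1
  set E₁ := A ∩ aK + B ∩ bK with hE1
  have haU : a ∈ A ∪ B := Or.inl ha
  have hbU : b ∈ A ∪ B := Or.inr hb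
  by_cases hab : a - b ∈ K
  · have e : aK = bK := coset_eq_coset hab
    have h1 := ncard_hole lt1.le haU
    rw [← haK, Set.union_inter_distrib_right] at h1
    have h2 := ncard_union_add_subgroup_le (A ∩ aK) (B ∩ aK) (setStab E₁)
    rw [← e] at b1
    omega
  have step : ∀ K' ≤ K, ∀ m, m + Nat.card K' + ((A ∪ B) + (K : Set G)).ncard <
      Nat.card K + ((A ∪ B) + (K' : Set G)).ncard → m + Nat.card K' + Nat.card K <
      ((A ∩ aK) ∪ (B ∩ aK) + (K' : Set G)).ncard + ((B ∩ bK) ∪ (A ∩ bK) + (K' : Set G)).ncard := by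
    intro K' hK' m hm
    have h1 := ncard_two_holes hK' haU hbU hab
    rw [← haK, ← hbK, Set.union_inter_distrib_right, Set.union_inter_distrib_right,
      Set.union_comm (A ∩ bK)] at h1
    omega
  have n1 := step _ lt1.le _ c1
  have inA : (A ∩ aK) ∪ (B ∩ aK) ⊆ aK := Set.union_subset Set.inter_subset_right
    Set.inter_subset_right
  have inB : (B ∩ bK) ∪ (A ∩ bK) ⊆ bK := Set.union_subset Set.inter_subset_right
    Set.inter_subset_right
  have iA := ncard_add_subgroup_le_of_subset_coset inA lt1.le
  have iB := ncard_add_subgroup_le_of_subset_coset inB lt1.le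
  rcases (B ∩ aK).eq_empty_or_nonempty with hX' | nX'
  · rw [hX', Set.union_empty] at n1
    omega
  rcases (A ∩ bK).eq_empty_or_nonempty with hW' | nW'
  · rw [hW', Set.union_empty] at n1
    omega
  have b2 := IH _ _ nW' nX' (small _ E2sub E2P)
  have lt2 := proper _ E2sub E2P (nW'.add nX')
  have H2 : setStab (A + B) ≤ setStab (A ∩ bK + B ∩ aK) :=
    le_setStab_add_right (le_setStab_inter hA stabB) _
  have c2 := not_convergent_ineq hC lt2.le H2 E2sub le_rfl E2P hCP (nonconv _ _ lt2)
  unfold KneserBound at b2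
  set E₂ := A ∩ bK + B ∩ aK with hE2
  have n2 := step _ lt2.le _ c2
  have lt3 : setStab E₁ ⊓ setStab E₂ < K := lt_of_le_of_lt inf_le_left lt1
  have c3 := not_convergent_ineq hC lt3.le (le_inf H1 H2) (Set.union_subset E1sub E2sub)
    (le_setStab_union inf_le_left inf_le_right) (Set.union_subset E1P E2P) hCP (nonconv _ _ lt3)
  have n3 := step _ lt3.le _ c3
  rcases le_total (Nat.card (setStab E₂)) (Nat.card (setStab E₁)) with hle | hle
  · exact kneser_numeric inA inB lt1.le le_rfl b1 b2 n1 n3 hle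
  · rw [Set.union_comm (A ∩ aK), Set.union_comm (B ∩ bK)] at n2 n3
    rw [Set.union_comm (A ∩ aK)] at inA
    rw [Set.union_comm (B ∩ bK)] at inB
    rw [Set.union_comm E₁, inf_comm] at n3
    exact kneser_numeric inA inB lt2.le le_rfl (by omega) (by omega) n2 n3 hle

end

section
open scoped Pointwise Classical

variable {G : Type*} [AddCommGroup G]

theorem add_vadd_set_eq (A B : Set G) (c : G) : A + (c +ᵥ B) = c +ᵥ (A + B) := by
  rw [← Set.singleton_vadd, ← Set.singleton_vadd, vadd_eq_add, vadd_eq_add, add_left_comm]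

theorem ncard_le_ncard_add_left [Finite G] {A : Set G} (hA : A.Nonempty) (B : Set G) :
    B.ncard ≤ (A + B).ncard := by
  obtain ⟨a, ha⟩ := hA
  rw [← Set.ncard_vadd_set a B]
  refine Set.ncard_le_ncard ?_
  rintro _ ⟨b, hb, rfl⟩
  exact Set.add_mem_add ha hb

theorem mem_setStab_of_forall [Finite G] {A : Set G} {g : G} (h : ∀ x ∈ A, g + x ∈ A) :
    g ∈ setStab A := by
  have h1 : g +ᵥ A ⊆ A := by
    rintro _ ⟨x, hx, rfl⟩
    exact h x hx
  have h2 := Set.eq_of_subset_of_ncard_le h1 (Set.ncard_vadd_set g A).ge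
  intro x
  conv_lhs => rw [← h2]
  exact Set.vadd_mem_vadd_set_iff

theorem setStab_le_setStab_add_right (A B : Set G) : setStab B ≤ setStab (A + B) :=
  le_setStab_add_left le_rfl A

theorem exists_convergent_setStab [Finite G] {A B : Set G}
    (hA : setStab (A + B) ≤ setStab A)
    (IH : ∀ A' B' : Set G, A'.Nonempty → B'.Nonempty → (A' + B').ncard < (A + B).ncard →
      KneserBound A' B') (m : ℕ) :
    ∀ C K, IsConvergent A B C K → Nat.card K = m → ∃ C, IsConvergent A B C (setStab (A + B)) := by
  induction m using Nat.strong_induction_on with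
  | _ m ih =>
    intro C K hC hm
    by_cases hK : K = setStab (A + B)
    · exact ⟨C, hK ▸ hC⟩
    · obtain ⟨C', K', h1, h2⟩ := exists_smaller_convergent hA IH hC hK
      exact ih _ (hm ▸ h2) C' K' h1 rfl

theorem kneserBound_of_periodic {A B : Set G}
    (h : ∀ A' B' : Set G, A' = A + (setStab (A + B) : Set G) →
      B' = B + (setStab (A + B) : Set G) → A' + B' = A + B →
      A'.ncard + B'.ncard ≤ (A' + B').ncard + Nat.card (setStab (A' + B'))) :
    KneserBound A B := by
  have h1 : (A + (setStab (A + B) : Set G)) + (B + (setStab (A + B) : Set G)) = A + B := by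
    rw [add_add_subgroup, add_setStab]
  have := h _ _ rfl rfl h1
  rwa [h1] at this

theorem kneser_periodic [Finite G] {p : ℕ}
    (IH : ∀ A' B' : Set G, A'.Nonempty → B'.Nonempty → (A' + B').ncard < p →
      KneserBound A' B') (q : ℕ) :
    ∀ A B : Set G, A.Nonempty → B.Nonempty → (A + B).ncard = p → A.ncard = q →
      setStab (A + B) ≤ setStab A → setStab (A + B) ≤ setStab B →
      A.ncard + B.ncard ≤ (A + B).ncard + Nat.card (setStab (A + B)) := by
  induction q using Nat.strong_induction_on with
  | _ q ih =>
    intro A B nA nB hp hq hA hB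
    by_cases hex : ∃ a ∈ A, ∃ a' ∈ A, a' - a ∉ setStab (A + B)
    · obtain ⟨a, ha, a', ha', haa⟩ := hex
      have hB' : a' - a ∉ setStab B := fun h => haa (setStab_le_setStab_add_right A B h)
      obtain ⟨b, hb, hab⟩ : ∃ b ∈ B, a' - a + b ∉ B := by
        by_contra! hcon
        exact hB' (mem_setStab_of_forall hcon)
      have aB : a ∈ (a - b) +ᵥ B := ⟨b, hb, sub_add_cancel a b⟩
      have aB' : a' ∉ (a - b) +ᵥ B := by
        rw [Set.mem_vadd_set_iff_neg_vadd_mem, vadd_eq_add]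
        have : -(a - b) + a' = a' - a + b := by abel
        rwa [this]
      have hsum := add_vadd_set_eq A B (a - b)
      have hp' : (A + ((a - b) +ᵥ B)).ncard = p := by rw [hsum, Set.ncard_vadd_set, hp]
      have hst : setStab (A + ((a - b) +ᵥ B)) = setStab (A + B) := by rw [hsum, setStab_vadd]
      have hBst : setStab (A + B) ≤ setStab ((a - b) +ᵥ B) := by rwa [setStab_vadd]
      rw [hp, ← hp', ← hst, ← Set.ncard_vadd_set (a - b) B]
      rw [← hst] at hA hBst
      generalize (a - b) +ᵥ B = B at *
      clear! b
      have nI : (A ∩ B).Nonempty := ⟨a, ha, aB⟩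
      have nU : (A ∪ B).Nonempty := ⟨a, Or.inl ha⟩
      have hlt : (A ∩ B).ncard < A.ncard :=
        Set.ncard_lt_ncard ⟨Set.inter_subset_left, fun h => aB' (h ha').2⟩
      have hsub : (A ∩ B) + (A ∪ B) ⊆ A + B := Set.inter_add_union_subset
      have hH : setStab (A + B) ≤ setStab ((A ∩ B) + (A ∪ B)) :=
        le_setStab_add_right (le_setStab_inter hA hBst) _
      have key : KneserBound (A ∩ B) (A ∪ B) := by
        rcases (Set.ncard_le_ncard hsub).lt_or_eq with h | h
        · exact IH _ _ nI nU (hp' ▸ h)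
        · have he := Set.eq_of_subset_of_ncard_le hsub h.ge
          have h1 := ih _ (hq ▸ hlt) (A ∩ B) (A ∪ B) nI nU (h.trans hp') rfl
            (he ▸ le_setStab_inter hA hBst) (he ▸ le_setStab_union hA hBst)
          unfold KneserBound
          rw [he] at h1 ⊢
          rwa [le_setStab_iff.1 (le_setStab_inter hA hBst),
            le_setStab_iff.1 (le_setStab_union hA hBst)]
      have hconv : IsConvergent A B ((A ∩ B) + (A ∪ B)) (setStab ((A ∩ B) + (A ∪ B))) := by
        refine ⟨nI.add nU, hsub, le_rfl, hH, ?_⟩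
        have := Set.ncard_le_ncard (subset_add_subgroup (A ∩ B) (setStab ((A ∩ B) + (A ∪ B))))
        unfold KneserBound at key
        omega
      obtain ⟨C, -, h2, -, -, h5⟩ :=
        exists_convergent_setStab hA (hp' ▸ IH) _ _ _ hconv rfl
      rw [le_setStab_iff.1 (le_setStab_union hA hBst)] at h5
      have h6 := Set.ncard_le_ncard h2
      have h7 := Set.ncard_inter_add_ncard_union A B
      omega
    · push Not at hex
      obtain ⟨a, ha⟩ := nA
      have h1 : A ⊆ a +ᵥ (setStab (A + B) : Set G) := fun x hx =>
        mem_coset_iff.2 (hex a ha x hx)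
      have h2 := Set.ncard_le_ncard h1
      rw [ncard_coset] at h2
      have h3 := ncard_le_ncard_add_left ⟨a, ha⟩ B
      omega

/-- Kneser's theorem for two sets. -/
theorem kneser [Finite G] {A B : Set G} (hA : A.Nonempty) (hB : B.Nonempty) :
    KneserBound A B := by
  obtain ⟨p, hp⟩ : ∃ p, (A + B).ncard = p := ⟨_, rfl⟩
  induction p using Nat.strong_induction_on generalizing A B with
  | _ p ih =>
    refine kneserBound_of_periodic ?_
    intro A' B' hA' hB' hs
    refine kneser_periodic (fun C D hC hD h => ih _ h hC hD rfl) _ A' B' ?_ ?_ (hs ▸ hp) rfl ?_ ?_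
    · exact hA' ▸ hA.mono (subset_add_subgroup _ _)
    · exact hB' ▸ hB.mono (subset_add_subgroup _ _)
    · rw [hs, hA']
      exact le_setStab_add_subgroup _ _
    · rw [hs, hB']
      exact le_setStab_add_subgroup _ _

theorem kneser_of_setStab_le [Finite G] {A B : Set G} {H : AddSubgroup G} (hA : A.Nonempty)
    (hB : B.Nonempty) (hH : setStab (A + B + (H : Set G)) ≤ H) :
    (A + (H : Set G)).ncard + (B + (H : Set G)).ncard ≤
      (A + B + (H : Set G)).ncard + Nat.card H := by
  have h := kneser (hA.mono (subset_add_subgroup _ H)) (hB.mono (subset_add_subgroup _ H))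
  unfold KneserBound at h
  rwa [add_add_subgroup, le_antisymm hH (le_setStab_add_subgroup _ _), add_assoc, add_assoc,
    subgroup_add_self] at h

theorem finsetSum_nonempty {ι : Type*} {s : Finset ι} {A : ι → Set G}
    (hA : ∀ i ∈ s, (A i).Nonempty) : (∑ i ∈ s, A i).Nonempty := by
  have : ∀ i : ι, ∃ x, i ∈ s → x ∈ A i := by
    intro i
    by_cases hi : i ∈ s
    · obtain ⟨x, hx⟩ := hA i hi
      exact ⟨x, fun _ => hx⟩
    · exact ⟨0, fun h => absurd h hi⟩
  choose f hf using this
  exact ⟨∑ i ∈ s, f i, Set.finsetSum_mem_finsetSum s A f hf⟩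

/-- Kneser's theorem for a family of sets. -/
theorem kneser_sum [Finite G] {ι : Type*} (s : Finset ι) (A : ι → Set G)
    (hA : ∀ i ∈ s, (A i).Nonempty) (H : AddSubgroup G)
    (hH : setStab (∑ i ∈ s, A i + (H : Set G)) ≤ H) :
    ∑ i ∈ s, (A i + (H : Set G)).ncard + Nat.card H ≤
      (∑ i ∈ s, A i + (H : Set G)).ncard + s.card * Nat.card H := by
  induction s using Finset.induction_on with
  | empty =>
    simp only [Finset.sum_empty, zero_add, Finset.card_empty, zero_mul, add_zero]
    exact (Nat.card_coe_set_eq (H : Set G)).le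
  | insert a s ha ih =>
    rw [Finset.sum_insert ha, Finset.sum_insert ha, Finset.card_insert_of_notMem ha]
    rw [Finset.sum_insert ha] at hH
    have hA' := fun i hi => hA i (Finset.mem_insert_of_mem hi)
    have h1 := kneser_of_setStab_le (hA a (Finset.mem_insert_self a s)) (finsetSum_nonempty hA') hH
    rw [add_assoc] at hH
    have h2 := ih hA' ((setStab_le_setStab_add_right _ _).trans hH)
    rw [add_one_mul]
    omega

end

section
open scoped Pointwise Classical

theorem exists_le_le_card_eq {α : Type*} {T S : Multiset α} {n : ℕ} (hTS : T ≤ S)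
    (hT : Multiset.card T ≤ n) (hS : n ≤ Multiset.card S) :
    ∃ R, T ≤ R ∧ R ≤ S ∧ Multiset.card R = n := by
  obtain ⟨U, rfl⟩ := Multiset.le_iff_exists_add.1 hTS
  rw [Multiset.card_add] at hS
  have hpos : 0 < Multiset.card (Multiset.powersetCard (n - Multiset.card T) U) := by
    rw [Multiset.card_powersetCard]
    exact Nat.choose_pos (by omega)
  obtain ⟨V, hV⟩ := Multiset.card_pos_iff_exists_mem.1 hpos
  rw [Multiset.mem_powersetCard] at hV
  refine ⟨T + V, Multiset.le_add_right _ _, Multiset.add_le_add_left hV.1, ?_⟩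
  rw [Multiset.card_add, hV.2]
  omega

theorem exists_le_card_eq {α : Type*} {S : Multiset α} {n : ℕ} (hS : n ≤ Multiset.card S) :
    ∃ R, R ≤ S ∧ Multiset.card R = n := by
  obtain ⟨R, -, h⟩ := exists_le_le_card_eq (Multiset.zero_le S) (Nat.zero_le _) hS
  exact ⟨R, h⟩

theorem countP_le_countP_of_imp {α : Type*} {p q : α → Prop} (S : Multiset α)
    (h : ∀ a, p a → q a) : S.countP p ≤ S.countP q := by
  rw [Multiset.countP_eq_card_filter, Multiset.countP_eq_card_filter]
  exact Multiset.card_le_card (Multiset.monotone_filter_right S h)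

section Partition

variable {α β : Type*} [Fintype β] [DecidableEq β] (S : Multiset α) (f : α → β)

theorem sum_filter_eq_self : ∑ b, S.filter (fun a => f a = b) = S := by
  ext a
  simp [Multiset.count_sum', Multiset.count_filter]

theorem sum_countP_eq_card : ∑ b, S.countP (fun a => f a = b) = Multiset.card S := by
  conv_rhs => rw [← sum_filter_eq_self S f, Multiset.card_sum]
  simp [Multiset.countP_eq_card_filter]

/-- Choosing a prescribed number of terms from every fibre. -/
theorem exists_le_countP_eq (m : β → ℕ) (hm : ∀ b, m b ≤ S.countP (fun a => f a = b)) :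
    ∃ R ≤ S, ∀ b, R.countP (fun a => f a = b) = m b := by
  have : ∀ b, ∃ R, R ≤ S.filter (fun a => f a = b) ∧ Multiset.card R = m b := fun b =>
    exists_le_card_eq (by rw [← Multiset.countP_eq_card_filter]; exact hm b)
  choose R hR hR' using this
  refine ⟨∑ b, R b, ?_, fun b => ?_⟩
  · conv_rhs => rw [← sum_filter_eq_self S f]
    exact Finset.sum_le_sum fun b _ => hR b
  · rw [← Multiset.coe_countPAddMonoidHom, map_sum, Finset.sum_eq_single b]
    · rw [Multiset.coe_countPAddMonoidHom, ← hR' b, Multiset.countP_eq_card]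
      intro a ha
      exact (Multiset.mem_filter.1 (Multiset.mem_of_le (hR b) ha)).2
    · intro c _ hc
      rw [Multiset.coe_countPAddMonoidHom, Multiset.countP_eq_zero]
      intro a ha h
      exact hc ((Multiset.mem_filter.1 (Multiset.mem_of_le (hR c) ha)).2.symm.trans h)
    · simp

end Partition

variable {G : Type*} [AddCommGroup G]

/-- The number of terms of `S` lying in the coset `x + K`. -/
noncomputable def cosetCount (K : AddSubgroup G) (S : Multiset G) (x : G) : ℕ :=
  S.countP fun y => y - x ∈ K

theorem quotient_mk_eq_iff {K : AddSubgroup G} {x y : G} :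
    (QuotientAddGroup.mk x : G ⧸ K) = QuotientAddGroup.mk y ↔ x - y ∈ K := by
  rw [QuotientAddGroup.eq_iff_sub_mem]

theorem cosetCount_eq_countP (K : AddSubgroup G) (S : Multiset G) (x : G) :
    cosetCount K S x =
      S.countP fun y => (QuotientAddGroup.mk y : G ⧸ K) = QuotientAddGroup.mk x := by
  unfold cosetCount
  congr! 2 with y
  exact quotient_mk_eq_iff.symm

theorem cosetCount_eq_count_map (K : AddSubgroup G) (S : Multiset G) (x : G) :
    cosetCount K S x = (S.map (QuotientAddGroup.mk : G → G ⧸ K)).count (QuotientAddGroup.mk x) := by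
  rw [cosetCount_eq_countP, Multiset.count, Multiset.countP_map, Multiset.countP_eq_card_filter]
  congr 2
  ext y
  exact eq_comm

theorem cosetCount_add_left {K : AddSubgroup G} (S : Multiset G) {k : G} (hk : k ∈ K) (x : G) :
    cosetCount K S (k + x) = cosetCount K S x := by
  rw [cosetCount_eq_countP, cosetCount_eq_countP]
  have : (QuotientAddGroup.mk (k + x) : G ⧸ K) = QuotientAddGroup.mk x := by
    rw [quotient_mk_eq_iff]
    simpa using hk
  rw [this]

theorem cosetCount_mono_left {K K' : AddSubgroup G} (h : K ≤ K') (S : Multiset G) (x : G) :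
    cosetCount K S x ≤ cosetCount K' S x :=
  countP_le_countP_of_imp S fun _ ha => h ha

theorem cosetCount_mono_right (K : AddSubgroup G) {T S : Multiset G} (h : T ≤ S) (x : G) :
    cosetCount K T x ≤ cosetCount K S x :=
  Multiset.countP_le_of_le _ h

theorem cosetCount_le_card (K : AddSubgroup G) (S : Multiset G) (x : G) :
    cosetCount K S x ≤ Multiset.card S :=
  Multiset.countP_le_card _ _

theorem count_le_cosetCount (K : AddSubgroup G) (S : Multiset G) (x : G) :
    S.count x ≤ cosetCount K S x := by
  refine countP_le_countP_of_imp S ?_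
  rintro a rfl
  simp

theorem cosetCount_bot (S : Multiset G) (x : G) : cosetCount ⊥ S x = S.count x := by
  have : (fun y => y - x ∈ (⊥ : AddSubgroup G)) = fun y => x = y := by
    ext y
    rw [AddSubgroup.mem_bot, sub_eq_zero, eq_comm]
  unfold cosetCount Multiset.count
  congr 1

theorem cosetCount_cons (K : AddSubgroup G) (a : G) (S : Multiset G) (x : G) :
    cosetCount K (a ::ₘ S) x = cosetCount K S x + if a - x ∈ K then 1 else 0 :=
  Multiset.countP_cons _ _ _

theorem preimage_image_quotient_mk (H : AddSubgroup G) (A : Set G) :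
    (QuotientAddGroup.mk : G → G ⧸ H) ⁻¹' ((QuotientAddGroup.mk : G → G ⧸ H) '' A) =
      A + (H : Set G) := by
  ext x
  rw [mem_add_subgroup]
  constructor
  · rintro ⟨y, hy, hxy⟩
    exact ⟨y, hy, quotient_mk_eq_iff.1 hxy.symm⟩
  · rintro ⟨y, hy, hxy⟩
    exact ⟨y, hy, (quotient_mk_eq_iff.2 hxy).symm⟩

theorem ncard_add_subgroup_eq (H : AddSubgroup G) (A : Set G) :
    (A + (H : Set G)).ncard =
      Nat.card H * ((QuotientAddGroup.mk : G → G ⧸ H) '' A).ncard := by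
  rw [← preimage_image_quotient_mk, ← Nat.card_coe_set_eq, Nat.card_congr
    (QuotientAddGroup.preimageMkEquivAddSubgroupProdSet H _), Nat.card_prod, Nat.card_coe_set_eq]

variable [Fintype G]

theorem card_filter_sub_mem (K : AddSubgroup G) (a : G) :
    (Finset.univ.filter fun y => a - y ∈ K).card = Nat.card K := by
  rw [← ncard_coset K a, ← Set.ncard_coe_finset]
  congr 1
  ext y
  rw [mem_coset_iff, ← K.neg_mem_iff]
  simp

theorem sum_ite_cosetCount {K K' : AddSubgroup G} (h : K ≤ K') (T : Multiset G) (x : G) :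
    ∑ y, (if y - x ∈ K' then cosetCount K T y else 0) = Nat.card K * cosetCount K' T x := by
  induction T using Multiset.induction_on with
  | empty => simp [cosetCount]
  | cons a T ih =>
    rw [cosetCount_cons, mul_add, ← ih]
    have h1 : ∀ y, (if y - x ∈ K' then cosetCount K (a ::ₘ T) y else 0) =
        (if y - x ∈ K' then cosetCount K T y else 0) +
          if a - x ∈ K' then (if a - y ∈ K then 1 else 0) else 0 := by
      intro y
      rw [cosetCount_cons]
      have h2 : a - y ∈ K → (y - x ∈ K' ↔ a - x ∈ K') := by
        intro hy
        have h3 := h hy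
        constructor
        · intro h4
          simpa using K'.add_mem h3 h4
        · intro h4
          simpa using K'.sub_mem h4 h3
      by_cases h3 : a - y ∈ K
      · simp only [h3, h2 h3, if_true]
        split_ifs <;> rfl
      · simp [h3]
    simp only [h1, Finset.sum_add_distrib]
    congr 1
    by_cases h4 : a - x ∈ K'
    · simp only [h4, if_true, mul_one]
      rw [Finset.sum_boole, card_filter_sub_mem]
      simp
    · simp [h4]

theorem sum_cosetCount (K : AddSubgroup G) (T : Multiset G) :
    ∑ y, cosetCount K T y = Nat.card K * Multiset.card T := by
  have h := sum_ite_cosetCount (le_top : K ≤ ⊤) T 0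
  simpa [cosetCount] using h

theorem cosetCount_le_cosetCount {K K' : AddSubgroup G} (h : K ≤ K') {T R : Multiset G}
    (hTR : ∀ x, cosetCount K T x ≤ cosetCount K R x) (x : G) :
    cosetCount K' T x ≤ cosetCount K' R x := by
  refine Nat.le_of_mul_le_mul_left ?_ (Nat.card_pos : 0 < Nat.card K)
  rw [← sum_ite_cosetCount h, ← sum_ite_cosetCount h]
  refine Finset.sum_le_sum fun y _ => ?_
  split_ifs
  · exact hTR y
  · exact le_rfl

theorem sum_comp_quotient_mk (H : AddSubgroup G) (f : G ⧸ H → ℕ) :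
    ∑ x : G, f (QuotientAddGroup.mk x) = Nat.card H * ∑ q, f q := by
  rw [← Finset.sum_fiberwise (s := Finset.univ) (g := (QuotientAddGroup.mk : G → G ⧸ H)),
    Finset.mul_sum]
  refine Finset.sum_congr rfl fun q _ => ?_
  obtain ⟨a, rfl⟩ := QuotientAddGroup.mk_surjective q
  have h1 : ∀ x ∈ Finset.univ.filter (fun x : G => (QuotientAddGroup.mk x : G ⧸ H) =
      QuotientAddGroup.mk a), f (QuotientAddGroup.mk x) = f (QuotientAddGroup.mk a) := by
    intro x hx
    rw [(Finset.mem_filter.1 hx).2]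
  rw [Finset.sum_congr rfl h1, Finset.sum_const, smul_eq_mul, ← card_filter_sub_mem H a]
  congr 2
  ext x
  simp only [Finset.mem_filter, Finset.mem_univ, true_and]
  rw [eq_comm, quotient_mk_eq_iff]

end

section
open scoped Pointwise Classical

theorem subseqSums_mono {G : Type*} [AddCommGroup G] {T S : Multiset G} (h : T ≤ S) (n : ℕ) :
    subseqSums T n ⊆ subseqSums S n := by
  rintro x ⟨R, hR, h1, h2⟩
  exact ⟨R, hR.trans h, h1, h2⟩

theorem subseqSums_nonempty {G : Type*} [AddCommGroup G] {S : Multiset G} {n : ℕ}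
    (h : n ≤ Multiset.card S) : (subseqSums S n).Nonempty := by
  obtain ⟨R, hR, hR'⟩ := exists_le_card_eq h
  exact ⟨_, R, hR, hR', rfl⟩

theorem subseqSums_map {G L : Type*} [AddCommGroup G] [AddCommGroup L] (f : G →+ L)
    (S : Multiset G) (n : ℕ) : subseqSums (S.map f) n = f '' subseqSums S n := by
  ext x
  constructor
  · rintro ⟨T, hT, h1, rfl⟩
    have : T ∈ Multiset.powersetCard n (S.map f) := Multiset.mem_powersetCard.2 ⟨hT, h1⟩
    rw [Multiset.powersetCard_map, Multiset.mem_map] at this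
    obtain ⟨R, hR, rfl⟩ := this
    rw [Multiset.mem_powersetCard] at hR
    exact ⟨R.sum, ⟨R, hR.1, hR.2, rfl⟩, map_multiset_sum f R⟩
  · rintro ⟨_, ⟨R, hR, h1, rfl⟩, rfl⟩
    exact ⟨R.map f, Multiset.map_le_map hR, by rw [Multiset.card_map, h1],
      (map_multiset_sum f R).symm⟩

theorem setStab_image_quotient_mk {G : Type*} [AddCommGroup G] {H : AddSubgroup G} {A : Set G}
    (h : setStab (A + (H : Set G)) ≤ H) :
    setStab ((QuotientAddGroup.mk : G → G ⧸ H) '' A) = ⊥ := by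
  rw [eq_bot_iff]
  intro q hq
  obtain ⟨g, rfl⟩ := QuotientAddGroup.mk_surjective q
  rw [AddSubgroup.mem_bot, QuotientAddGroup.eq_zero_iff]
  apply h
  intro x
  rw [← preimage_image_quotient_mk]
  exact hq (QuotientAddGroup.mk x)

universe u

/-- The DeVos–Goddyn–Mohar bound for sets of subsequence sums with trivial stabilizer and at
most `N` elements. -/
def DGMBound (N : ℕ) : Prop :=
  ∀ (G : Type u) [AddCommGroup G] [Fintype G] (S : Multiset G) (n : ℕ),
    n ≤ Multiset.card S → setStab (subseqSums S n) = ⊥ → (subseqSums S n).ncard ≤ N →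
      ∑ x, min n (S.count x) + 1 ≤ (subseqSums S n).ncard + n

theorem DGMBound.relative {N : ℕ} (h : DGMBound.{u} N) {G : Type u} [AddCommGroup G] [Fintype G]
    {H : AddSubgroup G} {S : Multiset G} {n : ℕ} (hn : n ≤ Multiset.card S)
    (hH : setStab (subseqSums S n + (H : Set G)) ≤ H)
    (hN : (subseqSums S n + (H : Set G)).ncard ≤ N * Nat.card H) :
    ∑ x, min n (cosetCount H S x) + Nat.card H ≤
      (subseqSums S n + (H : Set G)).ncard + n * Nat.card H := by
  have hmap : subseqSums (S.map (QuotientAddGroup.mk : G → G ⧸ H)) n =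
      (QuotientAddGroup.mk : G → G ⧸ H) '' subseqSums S n :=
    subseqSums_map (QuotientAddGroup.mk' H) S n
  rw [ncard_add_subgroup_eq, mul_comm N] at hN
  have h1 := h (G ⧸ H) (S.map QuotientAddGroup.mk) n (by rwa [Multiset.card_map])
    (by rw [hmap]; exact setStab_image_quotient_mk hH)
    (by rw [hmap]; exact Nat.le_of_mul_le_mul_left hN Nat.card_pos)
  rw [hmap] at h1
  have h2 := sum_comp_quotient_mk H
    (fun q => min n ((S.map (QuotientAddGroup.mk : G → G ⧸ H)).count q))
  simp only [← cosetCount_eq_count_map] at h2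
  rw [h2, ncard_add_subgroup_eq]
  have h3 := Nat.mul_le_mul_left (Nat.card H) h1
  rw [mul_add, mul_add, mul_one, mul_comm _ n] at h3
  convert h3

/-- Distributing a sequence into `n` nonempty sets. -/
theorem exists_setpartition {G : Type*} (S : Multiset G) (n : ℕ) (hn : n ≤ Multiset.card S)
    (hS : ∀ x, S.count x ≤ n) :
    ∃ A : Fin n → Set G, (∀ i, (A i).Nonempty) ∧
      ∀ x, (Finset.univ.filter fun i => x ∈ A i).card = S.count x := by
  induction S using Multiset.induction_on with
  | empty =>
    obtain rfl : n = 0 := by simpa using hn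
    exact ⟨fun _ => ∅, fun i => i.elim0, fun x => by simp⟩
  | cons a S ih =>
    rcases hn.lt_or_eq with h | h
    · rw [Multiset.card_cons] at h
      obtain ⟨A, hA, hA'⟩ := ih (by omega) fun x =>
        (Multiset.count_le_count_cons x a S).trans (hS x)
      have h1 := hS a
      rw [Multiset.count_cons_self, ← hA'] at h1
      obtain ⟨i, hi⟩ : ∃ i, a ∉ A i := by
        by_contra! hcon
        rw [Finset.filter_true_of_mem fun i _ => hcon i, Finset.card_univ, Fintype.card_fin] at h1
        omega
      refine ⟨Function.update A i (insert a (A i)), fun j => ?_, fun x => ?_⟩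
      · by_cases hj : j = i
        · subst hj
          rw [Function.update_self]
          exact Set.insert_nonempty _ _
        · rw [Function.update_of_ne hj]
          exact hA j
      · by_cases hx : x = a
        · subst hx
          rw [Multiset.count_cons_self, ← hA']
          have : (Finset.univ.filter fun j => x ∈ Function.update A i (insert x (A i)) j) =
              insert i (Finset.univ.filter fun j => x ∈ A j) := by
            ext j
            by_cases hj : j = i
            · subst hj
              simp
            · simp [hj]
          rw [this, Finset.card_insert_of_notMem (by simpa using hi)]
        · rw [Multiset.count_cons_of_ne hx, ← hA']
          congr 2
          ext j
          by_cases hj : j = i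
          · subst hj
            simp [hx]
          · rw [Function.update_of_ne hj]
    · obtain ⟨l, hl⟩ : ∃ l : Fin n → G, Finset.univ.val.map l = a ::ₘ S := by
        obtain ⟨l, hl⟩ := Quot.exists_rep (a ::ₘ S)
        change (l : Multiset G) = _ at hl
        rw [← hl, Multiset.coe_card] at h
        subst h
        exact ⟨l.get, by rw [Fin.univ_val_map, List.ofFn_get, hl]⟩
      refine ⟨fun i => {l i}, fun i => Set.singleton_nonempty _, fun x => ?_⟩
      rw [← hl, Multiset.count_map]
      rfl

end

section
open scoped Pointwise Classical

universe u
variable {G : Type u} [AddCommGroup G]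

/-- The `n`-term subsequences of `S` with at most `f x` terms in every coset `x + K`. -/
def admissible (S : Multiset G) (n : ℕ) (K : AddSubgroup G) (f : G → ℕ) : Set (Multiset G) :=
  {T | T ≤ S ∧ Multiset.card T = n ∧ ∀ x, cosetCount K T x ≤ f x}

theorem cosetCount_filter_mk {K K' : AddSubgroup G} (h : K' ≤ K) (S : Multiset G) (x : G) :
    cosetCount K' (S.filter fun y => (QuotientAddGroup.mk y : G ⧸ K) = QuotientAddGroup.mk x) x =
      cosetCount K' S x := by
  unfold cosetCount
  rw [Multiset.countP_filter]
  congr 1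
  ext y
  rw [quotient_mk_eq_iff]
  exact ⟨fun hy => hy.1, fun hy => ⟨hy, h hy⟩⟩

theorem quotient_mk_sum_of_forall {K : AddSubgroup G} {q : G ⧸ K} {T : Multiset G}
    (h : ∀ y ∈ T, (QuotientAddGroup.mk y : G ⧸ K) = q) :
    (QuotientAddGroup.mk T.sum : G ⧸ K) = Multiset.card T • q := by
  have h1 : (QuotientAddGroup.mk T.sum : G ⧸ K) = (T.map (QuotientAddGroup.mk : G → G ⧸ K)).sum :=
    map_multiset_sum (QuotientAddGroup.mk' K) T
  rw [h1, Multiset.map_congr rfl h, Multiset.map_const', Multiset.sum_replicate]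

theorem quotient_mk_finsetSum {K : AddSubgroup G} {ι : Type*} (s : Finset ι) (a : ι → G) :
    (QuotientAddGroup.mk (∑ i ∈ s, a i) : G ⧸ K) = ∑ i ∈ s, (QuotientAddGroup.mk (a i) : G ⧸ K) :=
  map_sum (QuotientAddGroup.mk' K) a s

theorem multisetSum_finsetSum {ι : Type*} (s : Finset ι) (T : ι → Multiset G) :
    (∑ i ∈ s, T i).sum = ∑ i ∈ s, (T i).sum :=
  map_sum Multiset.sumAddMonoidHom T s

variable [Fintype G]

/-- A subgroup `K` together with a weight `f` witnessing a partial Kneser-type bound. -/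
structure IsGood (S : Multiset G) (n : ℕ) (K : AddSubgroup G) (f : G → ℕ) : Prop where
  inv : ∀ k ∈ K, ∀ x, f (k + x) = f x
  count_le : ∀ x, S.count x ≤ f x
  le_length : ∀ x, f x ≤ n
  le_cosetCount : ∀ x, f x ≤ cosetCount K S x
  exists_set : ∃ C ⊆ subseqSums S n, K ≤ setStab C ∧
    ∑ x, f x + Nat.card K ≤ C.ncard + n * Nat.card K
  nonempty : (admissible S n K f).Nonempty

/-- The sums of the subsequences of `S` having the same coset distribution as `T`. -/
theorem exists_sameDistribution_sums {S T : Multiset G} (K : AddSubgroup G)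
    (hT : T ≤ S) (N : ℕ) (IH : DGMBound.{u} N)
    (hN : ∀ D : Set G, D ⊆ subseqSums S (Multiset.card T) → D ⊆ T.sum +ᵥ (K : Set G) →
      D.ncard ≤ N) :
    ∃ D ⊆ subseqSums S (Multiset.card T), D ⊆ T.sum +ᵥ (K : Set G) ∧ D.Nonempty ∧
      (setStab D ≤ K → ∑ x, min (cosetCount K T x) (cosetCount (setStab D) S x) +
        Nat.card (setStab D) ≤ D.ncard + Multiset.card T * Nat.card (setStab D)) := by
  set F : G ⧸ K → Multiset G := fun q => S.filter fun y => (QuotientAddGroup.mk y : G ⧸ K) = q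
    with hF
  set c : G ⧸ K → ℕ := fun q => T.countP fun y => (QuotientAddGroup.mk y : G ⧸ K) = q with hc
  set E : G ⧸ K → Set G := fun q => subseqSums (F q) (c q) with hE
  have hcF : ∀ q, c q ≤ Multiset.card (F q) := by
    intro q
    rw [hF, ← Multiset.countP_eq_card_filter]
    exact Multiset.countP_le_of_le _ hT
  have hcsum : ∑ q, c q = Multiset.card T := sum_countP_eq_card T QuotientAddGroup.mk
  have nE : ∀ q ∈ Finset.univ, (E q).Nonempty := fun q _ => subseqSums_nonempty (hcF q)
  have hD1 : ∑ q, E q ⊆ subseqSums S (Multiset.card T) := by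
    intro x hx
    obtain ⟨a, ha, rfl⟩ := (Set.mem_finsetSum _ _ _).1 hx
    choose R hR hR1 hR2 using fun q => @ha q (Finset.mem_univ q)
    refine ⟨∑ q, R q, ?_, ?_, ?_⟩
    · conv_rhs => rw [← sum_filter_eq_self S (QuotientAddGroup.mk : G → G ⧸ K)]
      exact Finset.sum_le_sum fun q _ => hR q
    · rw [Multiset.card_sum, ← hcsum]
      exact Finset.sum_congr rfl fun q _ => hR1 q
    · rw [multisetSum_finsetSum]
      exact Finset.sum_congr rfl fun q _ => hR2 q
  have hmk : ∀ R : G ⧸ K → Multiset G, (∀ q, Multiset.card (R q) = c q) →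
      (∀ q, ∀ y ∈ R q, (QuotientAddGroup.mk y : G ⧸ K) = q) →
      (QuotientAddGroup.mk (∑ q, (R q).sum) : G ⧸ K) = ∑ q, c q • q := by
    intro R h1 h2
    rw [quotient_mk_finsetSum]
    refine Finset.sum_congr rfl fun q _ => ?_
    rw [quotient_mk_sum_of_forall (h2 q), h1]
  have hD2 : ∑ q, E q ⊆ T.sum +ᵥ (K : Set G) := by
    intro x hx
    obtain ⟨a, ha, rfl⟩ := (Set.mem_finsetSum _ _ _).1 hx
    choose R hR hR1 hR2 using fun q => @ha q (Finset.mem_univ q)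
    rw [mem_coset_iff, ← quotient_mk_eq_iff]
    have h1 := hmk R hR1 fun q y hy => (Multiset.mem_filter.1 (Multiset.mem_of_le (hR q) hy)).2
    have h2 := hmk (fun q => T.filter fun y => (QuotientAddGroup.mk y : G ⧸ K) = q)
      (fun q => (Multiset.countP_eq_card_filter _ _).symm)
      fun q y hy => (Multiset.mem_filter.1 hy).2
    rw [← multisetSum_finsetSum, sum_filter_eq_self] at h2
    rw [h2, ← h1]
    congr 1
    exact Finset.sum_congr rfl fun q _ => (hR2 q).symm
  refine ⟨∑ q, E q, hD1, hD2, finsetSum_nonempty nE, fun hle => ?_⟩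
  set K₁ := setStab (∑ q, E q) with hK₁
  have hDK : ∑ q, E q + (K₁ : Set G) = ∑ q, E q := add_setStab _
  have hsplit : ∀ q, ∃ R : Set G, R.Nonempty ∧ R + (E q + (K₁ : Set G)) = ∑ q, E q := by
    intro q
    refine ⟨∑ p ∈ Finset.univ.erase q, E p,
      finsetSum_nonempty fun p _ => nE p (Finset.mem_univ p), ?_⟩
    rw [← add_assoc, Finset.sum_erase_add _ _ (Finset.mem_univ q), hDK]
  have hq : ∀ q, ∑ x, min (c q) (cosetCount K₁ (F q) x) + Nat.card K₁ ≤
      (E q + (K₁ : Set G)).ncard + c q * Nat.card K₁ := by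
    intro q
    obtain ⟨R, hR, hR'⟩ := hsplit q
    refine IH.relative (hcF q) ?_ ?_
    · refine (setStab_le_setStab_add_right R _).trans ?_
      exact (congrArg setStab hR').le
    · refine (ncard_le_ncard_add_left hR _).trans ?_
      rw [show R + (subseqSums (F q) (c q) + (K₁ : Set G)) = ∑ q, E q from hR']
      exact (hN _ hD1 hD2).trans (Nat.le_mul_of_pos_right _ Nat.card_pos)
  have h1 := kneser_sum Finset.univ E nE K₁ (by rw [hDK])
  rw [hDK] at h1
  have h2 := Finset.sum_le_sum fun q (_ : q ∈ Finset.univ) => hq q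
  rw [Finset.sum_add_distrib, Finset.sum_add_distrib, Finset.sum_const, ← Finset.sum_mul, hcsum,
    smul_eq_mul, Finset.sum_comm] at h2
  have h3 : ∑ x, min (cosetCount K T x) (cosetCount K₁ S x) ≤
      ∑ x, ∑ q, min (c q) (cosetCount K₁ (F q) x) := by
    refine Finset.sum_le_sum fun x _ => ?_
    refine le_trans (le_of_eq ?_) (Finset.single_le_sum (fun _ _ => Nat.zero_le _)
      (Finset.mem_univ (QuotientAddGroup.mk x : G ⧸ K)))
    rw [hF, cosetCount_filter_mk hle, hc, cosetCount_eq_countP K T]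
  omega

theorem IsGood.card_le_ncard {S : Multiset G} {n : ℕ} {K : AddSubgroup G} {f : G → ℕ}
    (hG : IsGood S n K f) {C : Set G} 
    (hC : ∑ x, f x + Nat.card K ≤ C.ncard + n * Nat.card K) : Nat.card K ≤ C.ncard := by
  obtain ⟨T, -, hT2, hT3⟩ := hG.nonempty
  have h := Finset.sum_le_sum fun x (_ : x ∈ Finset.univ) => hT3 x
  rw [sum_cosetCount, hT2, mul_comm] at h
  omega

theorem IsGood.refine {S T : Multiset G} {n : ℕ} {K : AddSubgroup G} {f : G → ℕ}
    (hG : IsGood S n K f) (IH : DGMBound.{u} ((subseqSums S n).ncard - 1))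
    (hT : T ≤ S) (hTn : Multiset.card T = n)
    (hdef : ∑ x, (cosetCount K T x - f x) ≤ Nat.card K)
    (hnot : ¬ T.sum +ᵥ (K : Set G) ⊆ subseqSums S n) :
    ∃ K₁ g, IsGood S n K₁ g ∧ K₁ < K ∧ admissible S n K f ⊆ admissible S n K₁ g := by
  subst hTn
  obtain ⟨C, hCY, hCK, hC⟩ := hG.exists_set
  have hCpos := hG.card_le_ncard hC
  have hKpos : 0 < Nat.card K := Nat.card_pos
  have hdisj : Disjoint C (T.sum +ᵥ (K : Set G)) := by
    rw [Set.disjoint_left]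
    intro x hx hxT
    apply hnot
    rw [mem_coset_iff] at hxT
    rw [← coset_eq_coset hxT]
    exact (coset_subset hCK hx).trans hCY
  obtain ⟨D, hD1, hD2, hD3, hD4⟩ := exists_sameDistribution_sums K hT _ IH (by
    intro D h1 h2
    have h3 := Set.ncard_le_ncard (Set.union_subset hCY h1)
    rw [Set.ncard_union_eq (hdisj.mono_right h2)] at h3
    omega)
  have hle := setStab_le_of_subset_coset hD3 hD2
  have hlt : setStab D < K := by
    refine lt_of_le_of_ne hle fun he => hnot ?_
    obtain ⟨x, hx⟩ := hD3
    rw [← coset_eq_coset (mem_coset_iff.1 (hD2 hx))]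
    exact (coset_subset he.ge hx).trans hD1
  have h4 := hD4 hle
  set K₁ := setStab D with hK₁
  refine ⟨K₁, fun x => min (cosetCount K₁ S x) (f x), ⟨?_, ?_, ?_, ?_, ?_, ?_⟩, hlt, ?_⟩
  · intro k hk x
    simp only [cosetCount_add_left S hk, hG.inv k (hle hk)]
  · exact fun x => le_min (count_le_cosetCount _ _ _) (hG.count_le x)
  · exact fun x => (min_le_right _ _).trans (hG.le_length x)
  · exact fun x => min_le_left _ _
  · refine ⟨C ∪ D, Set.union_subset hCY hD1, le_setStab_union (hle.trans hCK) le_rfl, ?_⟩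
    rw [Set.ncard_union_eq (hdisj.mono_right hD2)]
    have h5 := Finset.sum_le_sum fun x (_ : x ∈ Finset.univ) =>
      show min (cosetCount K₁ S x) (f x) + cosetCount K T x ≤
        f x + min (cosetCount K T x) (cosetCount K₁ S x) + (cosetCount K T x - f x) by omega
    simp only [Finset.sum_add_distrib] at h5
    rw [sum_cosetCount, mul_comm] at h5
    omega
  · obtain ⟨R, h1, h2, h3⟩ := hG.nonempty
    exact ⟨R, h1, h2, fun x => le_min (cosetCount_mono_right _ h1 x)
      ((cosetCount_mono_left hle R x).trans (h3 x))⟩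
  · rintro R ⟨h1, h2, h3⟩
    exact ⟨h1, h2, fun x => le_min (cosetCount_mono_right _ h1 x)
      ((cosetCount_mono_left hle R x).trans (h3 x))⟩

end

section
open scoped Pointwise Classical

universe u

theorem exists_cosetCount_eq {G : Type u} [AddCommGroup G] [Finite G] (S : Multiset G)
    (K : AddSubgroup G)
    (h : G → ℕ) (hinv : ∀ k ∈ K, ∀ x, h (k + x) = h x) (hle : ∀ x, h x ≤ cosetCount K S x) :
    ∃ R ≤ S, ∀ x, cosetCount K R x = h x := by
  have : Fintype (G ⧸ K) := Fintype.ofFinite _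
  have key : ∀ q : G ⧸ K, (QuotientAddGroup.mk q.out : G ⧸ K) = q := fun q =>
    QuotientAddGroup.out_eq' q
  obtain ⟨R, hR, hR'⟩ := exists_le_countP_eq S (QuotientAddGroup.mk : G → G ⧸ K)
    (fun q => h q.out) (by
      intro q
      refine (hle _).trans ?_
      rw [cosetCount_eq_countP, key])
  refine ⟨R, hR, fun x => ?_⟩
  rw [cosetCount_eq_countP, hR']
  have h1 := quotient_mk_eq_iff.1 (key (QuotientAddGroup.mk x))
  rw [← hinv _ h1 x, sub_add_cancel]

variable {G : Type u} [AddCommGroup G] [Fintype G]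

theorem IsGood.extend {S : Multiset G} {n : ℕ} {K : AddSubgroup G} {f : G → ℕ}
    (hG : IsGood S n K f) (IH : DGMBound.{u} ((subseqSums S n).ncard - 1)) (hK : K ≠ ⊥)
    (hall : ∀ T ≤ S, Multiset.card T = n → ∑ x, (cosetCount K T x - f x) ≤ Nat.card K →
      T.sum +ᵥ (K : Set G) ⊆ subseqSums S n)
    (x₀ : G) (hx₀ : f x₀ < min n (cosetCount K S x₀)) :
    ∃ K' f', IsGood S n K' f' ∧ admissible S n K f ⊂ admissible S n K' f' := by
  set h : G → ℕ := fun x => f x + if x₀ - x ∈ K then 1 else 0 with hh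
  have hfx : ∀ x, x₀ - x ∈ K → f x = f x₀ := by
    intro x hx
    rw [← hG.inv _ hx x, sub_add_cancel]
  have hcx : ∀ x, x₀ - x ∈ K → cosetCount K S x = cosetCount K S x₀ := by
    intro x hx
    rw [← cosetCount_add_left S hx x, sub_add_cancel]
  obtain ⟨R, hRS, hR⟩ := exists_cosetCount_eq S K h (by
      intro k hk x
      simp only [hh, hG.inv k hk, ← sub_sub, sub_right_comm x₀ k x]
      congr 2
      simp only [eq_iff_iff]
      constructor
      · intro h1
        simpa using K.add_mem h1 hk
      · intro h1
        exact K.sub_mem h1 hk) (by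
      intro x
      simp only [hh]
      split_ifs with hx
      · rw [hfx x hx, hcx x hx]
        omega
      · exact hG.le_cosetCount x)
  have hle : ∀ x, f x ≤ cosetCount K R x := fun x => by
    rw [hR]
    exact Nat.le_add_right _ _
  have hnR : n ≤ Multiset.card R := by
    obtain ⟨T, -, hT2, hT3⟩ := hG.nonempty
    have h1 := Finset.sum_le_sum fun x (_ : x ∈ Finset.univ) => (hT3 x).trans (hle x)
    rw [sum_cosetCount, sum_cosetCount, hT2] at h1
    exact Nat.le_of_mul_le_mul_left h1 Nat.card_pos
  set Z := subseqSums R n with hZ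
  have hZK : Z + (K : Set G) ⊆ subseqSums S n := by
    intro y hy
    obtain ⟨_, ⟨T, hT, hT1, rfl⟩, hz⟩ := mem_add_subgroup.1 hy
    refine hall T (hT.trans hRS) hT1 ?_ (mem_coset_iff.2 hz)
    rw [← card_filter_sub_mem K x₀, Finset.card_filter]
    refine Finset.sum_le_sum fun x _ => ?_
    have h1 := cosetCount_mono_right K hT x
    rw [hR] at h1
    simp only [hh] at h1
    omega
  have nZ : Z.Nonempty := subseqSums_nonempty hnR
  set K' := setStab (Z + (K : Set G)) with hK'
  have hKK' : K ≤ K' := le_setStab_add_subgroup Z K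
  have hZK' : Z + (K' : Set G) = Z + (K : Set G) := by
    refine Set.Subset.antisymm ?_ (add_subgroup_mono Z hKK')
    exact add_subgroup_subset (subset_add_subgroup Z K) le_rfl
  have hcard : 2 ≤ Nat.card K := by
    by_contra hc
    exact hK ((AddSubgroup.card_le_one_iff_eq_bot K).1 (by omega))
  have hcard' : 2 ≤ Nat.card K' := hcard.trans (AddSubgroup.card_le_of_le hKK')
  have hY := Set.ncard_le_ncard hZK
  have hY2 : Nat.card K ≤ (subseqSums S n).ncard := by
    obtain ⟨z, hz⟩ := nZ
    rw [← ncard_coset K z]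
    exact Set.ncard_le_ncard ((coset_subset (le_setStab_add_subgroup Z K)
      (subset_add_subgroup Z K hz)).trans hZK)
  have hrel := IH.relative (H := K') hnR (by rw [← hZ, hZK']) (by
    rw [← hZ, hZK']
    calc (Z + (K : Set G)).ncard ≤ (subseqSums S n).ncard := hY
      _ ≤ ((subseqSums S n).ncard - 1) * 2 := by omega
      _ ≤ _ := Nat.mul_le_mul_left _ hcard')
  rw [← hZ, hZK'] at hrel
  have hsub : admissible S n K f ⊆ admissible S n K' fun x => min n (cosetCount K' R x) := by
    rintro T ⟨h1, h2, h3⟩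
    refine ⟨h1, h2, fun x => le_min (h2 ▸ cosetCount_le_card _ _ _) ?_⟩
    exact cosetCount_le_cosetCount hKK' (fun y => (h3 y).trans (hle y)) x
  refine ⟨K', fun x => min n (cosetCount K' R x), ⟨?_, ?_, ?_, ?_, ?_, ?_⟩, hsub, ?_⟩
  · intro k hk x
    simp only [cosetCount_add_left R hk]
  · intro x
    have h1 := hG.count_le x
    exact le_min (h1.trans (hG.le_length x))
      ((h1.trans (hle x)).trans (cosetCount_mono_left hKK' R x))
  · exact fun x => min_le_left _ _
  · exact fun x => (min_le_right _ _).trans (cosetCount_mono_right K' hRS x)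
  · exact ⟨Z + (K : Set G), hZK, le_rfl, hrel⟩
  · exact hG.nonempty.mono hsub
  · intro hcon
    have h1 : Multiset.card (R.filter fun y => y - x₀ ∈ K) ≤ n := by
      rw [← Multiset.countP_eq_card_filter]
      change cosetCount K R x₀ ≤ n
      rw [hR]
      simp only [hh, sub_self, K.zero_mem, if_true]
      omega
    obtain ⟨T, hT1, hT2, hT3⟩ := exists_le_le_card_eq (Multiset.filter_le _ R) h1 hnR
    have h2 : T ∈ admissible S n K' fun x => min n (cosetCount K' R x) :=
      ⟨hT2.trans hRS, hT3, fun x => le_min (hT3 ▸ cosetCount_le_card _ _ _)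
        (cosetCount_mono_right _ hT2 x)⟩
    have h3 := (hcon h2).2.2 x₀
    have h4 := cosetCount_mono_right K hT1 x₀
    have h5 : cosetCount K (R.filter fun y => y - x₀ ∈ K) x₀ = cosetCount K R x₀ := by
      unfold cosetCount
      rw [Multiset.countP_filter]
      simp
    rw [h5, hR] at h4
    simp only [hh, sub_self, K.zero_mem, if_true] at h4
    omega

theorem IsGood.bound {S : Multiset G} {n : ℕ} (IH : DGMBound.{u} ((subseqSums S n).ncard - 1))
    (hstab : setStab (subseqSums S n) = ⊥) (w : ℕ) :
    ∀ (K : AddSubgroup G) (f : G → ℕ), IsGood S n K f →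
      ({T | T ≤ S}.ncard - (admissible S n K f).ncard) * (Nat.card G + 1) + Nat.card K = w →
      ∑ x, S.count x + 1 ≤ (subseqSums S n).ncard + n := by
  induction w using Nat.strong_induction_on with
  | _ w ih =>
    intro K f hG hw
    have hfin : {T | T ≤ S}.Finite := by
      refine (Multiset.powerset S).toFinset.finite_toSet.subset fun T hT => ?_
      simpa using hT
    have hadm : ∀ K f, admissible S n K f ⊆ {T | T ≤ S} := fun K f T hT => hT.1
    have hcardK : ∀ K : AddSubgroup G, Nat.card K ≤ Nat.card G :=
      fun K => Nat.card_le_card_of_injective _ K.subtype_injective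
    by_cases hK : K = ⊥
    · obtain ⟨C, hC, -, hC2⟩ := hG.exists_set
      have h1 := Finset.sum_le_sum fun x (_ : x ∈ Finset.univ) => hG.count_le x
      have h2 := Set.ncard_le_ncard hC
      have h3 : Nat.card K = 1 := by
        rw [hK]
        simp
      rw [h3, mul_one] at hC2
      omega
    by_cases hall : ∀ T ≤ S, Multiset.card T = n → ∑ x, (cosetCount K T x - f x) ≤ Nat.card K →
      T.sum +ᵥ (K : Set G) ⊆ subseqSums S n
    · by_cases hx : ∃ x₀, f x₀ < min n (cosetCount K S x₀)
      · obtain ⟨x₀, hx₀⟩ := hx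
        obtain ⟨K', f', hG', hlt⟩ := hG.extend IH hK hall x₀ hx₀
        refine ih _ ?_ K' f' hG' rfl
        rw [← hw]
        have h1 := Set.ncard_lt_ncard hlt (hfin.subset (hadm _ _))
        have h2 := Set.ncard_le_ncard (hadm K' f') hfin
        have h3 := hcardK K'
        have h4 : Nat.card K > 0 := Nat.card_pos
        have h5 := Nat.mul_le_mul_right (Nat.card G + 1)
          (show {T | T ≤ S}.ncard - (admissible S n K' f').ncard + 1 ≤
            {T | T ≤ S}.ncard - (admissible S n K f).ncard by omega)
        rw [add_one_mul] at h5
        omega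
      · exfalso
        push Not at hx
        apply hK
        rw [eq_bot_iff, ← hstab]
        refine le_setStab_of_forall ?_
        rintro g hg _ ⟨T, hT, hTn, rfl⟩
        refine hall T hT hTn ?_ ?_
        · refine le_trans (le_of_eq (Finset.sum_eq_zero fun x _ => ?_)) (Nat.zero_le _)
          have h1 := (le_min (hTn ▸ cosetCount_le_card K T x)
            (cosetCount_mono_right K hT x)).trans (hx x)
          omega
        · rw [mem_coset_iff]
          simpa using hg
    · push Not at hall
      obtain ⟨T, hT, hTn, hdef, hnot⟩ := hall
      obtain ⟨K₁, g, hG', hlt, hsub⟩ := hG.refine IH hT hTn hdef hnot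
      refine ih _ ?_ K₁ g hG' rfl
      rw [← hw]
      have h1 := Set.ncard_le_ncard hsub (hfin.subset (hadm _ _))
      have h2 : Nat.card K₁ < Nat.card K := by
        rw [← SetLike.coe_sort_coe, ← SetLike.coe_sort_coe, Nat.card_coe_set_eq,
          Nat.card_coe_set_eq]
        exact Set.ncard_lt_ncard hlt
      have h5 := Nat.mul_le_mul_right (Nat.card G + 1)
          (show {T | T ≤ S}.ncard - (admissible S n K₁ g).ncard ≤
            {T | T ≤ S}.ncard - (admissible S n K f).ncard by omega)
      omega

theorem exists_isGood {S : Multiset G} {n : ℕ} (hn : n ≤ Multiset.card S)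
    (hS : ∀ x, S.count x ≤ n) : ∃ K f, IsGood S n K f := by
  obtain ⟨A, hA, hAS⟩ := exists_setpartition S n hn hS
  set C := ∑ i, A i with hC
  set K := setStab C with hK
  have hCK : C + (K : Set G) = C := add_setStab C
  have hsel : ∀ a : Fin n → G, (∀ i, a i ∈ A i) → Finset.univ.val.map a ≤ S := by
    intro a ha
    rw [Multiset.le_iff_count]
    intro x
    rw [Multiset.count_map, ← hAS x]
    refine Finset.card_le_card (s := Finset.univ.filter fun i => x = a i) ?_
    intro i hi
    rw [Finset.mem_filter] at hi ⊢
    exact ⟨hi.1, hi.2 ▸ ha i⟩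
  have hCY : C ⊆ subseqSums S n := by
    intro x hx
    obtain ⟨a, ha, rfl⟩ := (Set.mem_finsetSum _ _ _).1 hx
    refine ⟨Finset.univ.val.map a, hsel a fun i => ha (Finset.mem_univ i), ?_, rfl⟩
    simp
  have hkn := kneser_sum Finset.univ A (fun i _ => hA i) K (by rw [← hC, hCK])
  rw [← hC, hCK, Finset.card_univ, Fintype.card_fin] at hkn
  have hsum : ∑ x, (Finset.univ.filter fun i => x ∈ A i + (K : Set G)).card =
      ∑ i, (A i + (K : Set G)).ncard := by
    simp_rw [Finset.card_filter]
    rw [Finset.sum_comm]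
    refine Finset.sum_congr rfl fun i _ => ?_
    rw [← Finset.card_filter, ← Set.ncard_coe_finset]
    congr 1
    ext x
    simp
  refine ⟨K, fun x => (Finset.univ.filter fun i => x ∈ A i + (K : Set G)).card,
    ⟨?_, ?_, ?_, ?_, ?_, ?_⟩⟩
  · intro k hk x
    congr 2
    ext i
    exact le_setStab_add_subgroup (A i) K hk x
  · intro x
    rw [← hAS x]
    refine Finset.card_le_card fun i hi => ?_
    rw [Finset.mem_filter] at hi ⊢
    exact ⟨hi.1, subset_add_subgroup _ _ hi.2⟩
  · intro x
    refine (Finset.card_le_univ _).trans ?_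
    simp
  · intro x
    have h1 : cosetCount K S x = ∑ y, if y - x ∈ K then S.count y else 0 := by
      have := sum_ite_cosetCount (bot_le : ⊥ ≤ K) S x
      simp only [cosetCount_bot] at this
      simpa using this.symm
    rw [h1, ← Finset.sum_filter]
    simp_rw [← hAS, Finset.card_filter]
    rw [Finset.sum_comm]
    refine Finset.sum_le_sum fun i _ => ?_
    split_ifs with hx
    · obtain ⟨a, ha, hxa⟩ := mem_add_subgroup.1 hx
      have h2 : a ∈ Finset.univ.filter fun y => y - x ∈ K := by
        rw [Finset.mem_filter, ← K.neg_mem_iff]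
        simpa using hxa
      refine le_trans ?_ (Finset.single_le_sum (fun _ _ => Nat.zero_le _) h2)
      simp [ha]
    · exact Nat.zero_le _
  · exact ⟨C, hCY, le_rfl, by rw [hsum]; exact hkn⟩
  · choose a ha using hA
    refine ⟨Finset.univ.val.map a, hsel a ha, by simp, fun x => ?_⟩
    unfold cosetCount
    rw [Multiset.countP_map]
    refine Finset.card_le_card (s := Finset.univ.filter fun i => a i - x ∈ K) ?_
    intro i hi
    rw [Finset.mem_filter] at hi ⊢
    refine ⟨hi.1, mem_add_subgroup.2 ⟨a i, ha i, ?_⟩⟩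
    rw [← K.neg_mem_iff]
    simpa using hi.2

theorem subseqSums_truncate (S : Multiset G) (n : ℕ) :
    ∃ S' ≤ S, subseqSums S' n = subseqSums S n ∧ ∀ x, S'.count x = min n (S.count x) := by
  refine ⟨S ∩ n • Finset.univ.val, Multiset.inter_le_left, ?_, ?_⟩
  · refine Set.Subset.antisymm (subseqSums_mono Multiset.inter_le_left n) ?_
    rintro x ⟨T, hT, hTn, rfl⟩
    refine ⟨T, Multiset.le_inter hT ?_, hTn, rfl⟩
    rw [Multiset.le_iff_count]
    intro x
    rw [Multiset.count_nsmul, Multiset.count_univ, mul_one, ← hTn]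
    exact Multiset.count_le_card x T
  · intro x
    rw [Multiset.count_inter, Multiset.count_nsmul, Multiset.count_univ, mul_one, min_comm]

/-- The DeVos–Goddyn–Mohar theorem for sequences. -/
theorem dgmBound (N : ℕ) : DGMBound.{u} N := by
  induction N using Nat.strong_induction_on with
  | _ N ih =>
    intro G _ _ S n hn hst hN
    obtain ⟨S', hS', hY, hcount⟩ := subseqSums_truncate S n
    have hpos := (Set.ncard_pos).2 (subseqSums_nonempty hn)
    have hn' : n ≤ Multiset.card S' := by
      obtain ⟨_, T, hT, hTn, -⟩ := (hY ▸ subseqSums_nonempty hn : (subseqSums S' n).Nonempty)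
      exact hTn ▸ Multiset.card_le_card hT
    simp_rw [← hcount]
    rw [← hY] at hst hN hpos ⊢
    obtain ⟨K, f, hG⟩ := exists_isGood hn' fun x => hcount x ▸ min_le_left _ _
    exact hG.bound (ih _ (by omega)) hst _ K f rfl

end

section
open scoped Pointwise Classical

variable {G : Type*} [AddCommGroup G]

/-- A set meeting each of its nontrivial translates in at most one point. -/
def IsSidon (A : Set G) : Prop := ∀ d : G, d ≠ 0 → (A ∩ (d +ᵥ A)).ncard ≤ 1

theorem IsSidon.vadd {A : Set G} (h : IsSidon A) (c : G) : IsSidon (c +ᵥ A) := by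
  intro d hd
  rw [vadd_comm d c A, ← Set.vadd_set_inter, Set.ncard_vadd_set]
  exact h d hd

theorem IsSidon.inter_vadd_ncard_le {A : Set G} (h : IsSidon A) {x y : G} (hxy : x ≠ y) :
    ((x +ᵥ A) ∩ (y +ᵥ A)).ncard ≤ 1 := by
  have h1 := h.vadd x (y - x) (sub_ne_zero.2 hxy.symm)
  rwa [vadd_vadd, sub_add_cancel] at h1

theorem vadd_subset_add {A Z : Set G} {x : G} (hx : x ∈ Z) : x +ᵥ A ⊆ A + Z := by
  rintro _ ⟨a, ha, rfl⟩
  exact ⟨a, ha, x, hx, add_comm _ _⟩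

theorem IsSidon.two_mul_ncard_le [Finite G] {A Z : Set G} (h : IsSidon A) {x y : G} (hx : x ∈ Z)
    (hy : y ∈ Z) (hxy : x ≠ y) : 2 * A.ncard ≤ (A + Z).ncard + 1 := by
  have h1 := Set.ncard_union_add_ncard_inter (x +ᵥ A) (y +ᵥ A)
  have h2 := h.inter_vadd_ncard_le hxy
  have h3 := Set.ncard_le_ncard (Set.union_subset (vadd_subset_add (A := A) hx) (vadd_subset_add hy))
  rw [Set.ncard_vadd_set, Set.ncard_vadd_set] at h1
  omega

theorem IsSidon.three_mul_ncard_le [Finite G] {A Z : Set G} (h : IsSidon A) (hZ : 3 ≤ Z.ncard) :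
    3 * A.ncard ≤ (A + Z).ncard + 3 := by
  obtain ⟨T, hT, hT3⟩ := Set.exists_subset_card_eq hZ
  obtain ⟨x, y, z, hxy, hxz, hyz, rfl⟩ := Set.ncard_eq_three.1 hT3
  have hx : x ∈ Z := hT (by simp)
  have hy : y ∈ Z := hT (by simp)
  have hz : z ∈ Z := hT (by simp)
  have h1 := Set.ncard_union_add_ncard_inter (x +ᵥ A) (y +ᵥ A)
  have h1' := Set.ncard_union_add_ncard_inter ((x +ᵥ A) ∪ (y +ᵥ A)) (z +ᵥ A)
  have h2 := h.inter_vadd_ncard_le hxy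
  have h3 := Set.ncard_le_ncard (Set.union_subset (Set.union_subset (vadd_subset_add (A := A) hx)
    (vadd_subset_add hy)) (vadd_subset_add hz))
  have h4 := h.inter_vadd_ncard_le hxz
  have h5 := h.inter_vadd_ncard_le hyz
  have h6 := Set.ncard_union_le ((x +ᵥ A) ∩ (z +ᵥ A)) ((y +ᵥ A) ∩ (z +ᵥ A))
  rw [← Set.union_inter_distrib_right] at h6
  simp only [Set.ncard_vadd_set] at h1 h1'
  omega

theorem ncard_add_ncard_compl_le [Finite G] (A B : Set G) :
    (-(A + B)ᶜ + B).ncard + A.ncard ≤ Nat.card G := by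
  have h1 : -(A + B)ᶜ + B ⊆ -Aᶜ := by
    rintro _ ⟨x, hx, b, hb, rfl⟩ h
    exact hx ⟨_, h, b, hb, by simp⟩
  have h2 := Set.ncard_le_ncard h1
  have h3 := Set.ncard_add_ncard_compl A
  rw [Set.ncard_neg] at h2
  omega

/-- Existence of an atom: a set with small sumset which is either periodic under a translation
or meets the translate in at most one point. -/
theorem exists_atom [Finite G] {B X : Set G} (hB : B.Nonempty) (hX : 2 ≤ X.ncard)
    (hXB : (X + B).ncard + 2 ≤ Nat.card G) (hsmall : (X + B).ncard + 1 ≤ X.ncard + B.ncard) :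
    ∃ A : Set G, 2 ≤ A.ncard ∧ (A + B).ncard + 2 ≤ Nat.card G ∧
      (A + B).ncard + 1 ≤ A.ncard + B.ncard ∧
      ∀ d : G, d +ᵥ A = A ∨ (A ∩ (d +ᵥ A)).ncard ≤ 1 := by
  set P : Set (Set G) := {Z | 2 ≤ Z.ncard ∧ (Z + B).ncard + 2 ≤ Nat.card G} with hP
  have hle : ∀ Z : Set G, Z.ncard ≤ (Z + B).ncard := fun Z => by
    rw [add_comm]
    exact ncard_le_ncard_add_left hB Z
  obtain ⟨A₁, hA₁, hmin₁⟩ := Set.exists_min_image P (fun Z => (Z + B).ncard - Z.ncard)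
    (Set.toFinite _) ⟨X, hX, hXB⟩
  obtain ⟨A, ⟨hA, hA'⟩, hmin⟩ := Set.exists_min_image
    {Z ∈ P | (Z + B).ncard - Z.ncard = (A₁ + B).ncard - A₁.ncard} (fun Z => Z.ncard)
    (Set.toFinite _) ⟨A₁, hA₁, rfl⟩
  have hminκ : ∀ Z ∈ P, (A + B).ncard + Z.ncard ≤ (Z + B).ncard + A.ncard := fun Z hZ => by
    have := hmin₁ Z hZ
    have := hle Z
    have := hle A
    omega
  have hmincard : ∀ Z ∈ P, (Z + B).ncard + A.ncard ≤ (A + B).ncard + Z.ncard →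
      A.ncard ≤ Z.ncard := fun Z hZ h => by
    refine hmin Z ⟨hZ, ?_⟩
    have := hminκ Z hZ
    have := hle Z
    have := hle A
    omega
  have hdual : A.ncard + (A + B).ncard ≤ Nat.card G := by
    have h1 := ncard_add_ncard_compl_le A B
    have h2 := Set.ncard_add_ncard_compl (A + B)
    have h3 := Set.ncard_neg (A + B)ᶜ
    have h4 := hA.1
    have h5 := hA.2
    have := hmincard (-(A + B)ᶜ) ⟨by omega, by omega⟩ (by omega)
    omega
  refine ⟨A, hA.1, hA.2, ?_, fun d => ?_⟩
  · have := hminκ X ⟨hX, hXB⟩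
    omega
  by_contra! hd
  obtain ⟨hd1, hd2⟩ := hd
  have h1 := Set.ncard_union_add_ncard_inter A (d +ᵥ A)
  have h2 := Set.ncard_union_add_ncard_inter (A + B) ((d +ᵥ A) + B)
  have h3 : (A ∩ (d +ᵥ A)) + B ⊆ (A + B) ∩ ((d +ᵥ A) + B) :=
    Set.subset_inter (Set.add_subset_add_right Set.inter_subset_left)
      (Set.add_subset_add_right Set.inter_subset_right)
  have h4 : (A ∪ (d +ᵥ A)) + B = (A + B) ∪ ((d +ᵥ A) + B) := Set.union_add
  have h5 : ((d +ᵥ A) + B).ncard = (A + B).ncard := by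
    rw [add_comm, add_vadd_set_eq, Set.ncard_vadd_set, add_comm]
  have h6 := Set.ncard_le_ncard h3
  have h7 : (A ∩ (d +ᵥ A)).ncard < A.ncard := by
    refine Set.ncard_lt_ncard ⟨Set.inter_subset_left, fun h => hd1 ?_⟩
    refine (Set.eq_of_subset_of_ncard_le (fun x hx => (h hx).2) ?_).symm
    rw [Set.ncard_vadd_set]
  rw [← h4] at h2
  rw [Set.ncard_vadd_set] at h1
  have h8 := hA.2
  have hI : A ∩ (d +ᵥ A) ∈ P :=
    ⟨hd2, by have := Set.ncard_le_ncard (h3.trans Set.inter_subset_left); omega⟩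
  have h9 := hmincard _ hI
  by_cases hU : A ∪ (d +ᵥ A) ∈ P
  · have := hminκ _ hU
    omega
  · have h10 : ¬ ((A ∪ (d +ᵥ A) + B).ncard + 2 ≤ Nat.card G) := by
      intro h
      refine hU ⟨?_, h⟩
      omega
    omega

theorem mem_setStab_of_vadd_eq {A : Set G} {d : G} (h : d +ᵥ A = A) : d ∈ setStab A := by
  intro x
  conv_lhs => rw [← h]
  rw [← vadd_eq_add, Set.vadd_mem_vadd_set_iff]

/-- An atom is either a Sidon set or a coset. -/
theorem isSidon_or_eq_coset [Finite G] {A : Set G} (hA : A.Nonempty)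
    (h : ∀ d : G, d +ᵥ A = A ∨ (A ∩ (d +ᵥ A)).ncard ≤ 1) :
    IsSidon A ∨ ∃ (M : AddSubgroup G) (a : G), M ≠ ⊥ ∧ A = a +ᵥ (M : Set G) := by
  by_cases hst : setStab A = ⊥
  · left
    intro d hd
    refine (h d).resolve_left fun h' => hd ?_
    have := mem_setStab_of_vadd_eq h'
    rwa [hst] at this
  · right
    obtain ⟨a, ha⟩ := hA
    refine ⟨setStab A, a, hst, Set.Subset.antisymm (fun z hz => ?_) (coset_subset le_rfl ha)⟩
    obtain ⟨⟨k, hk⟩, hk0'⟩ := AddSubgroup.ne_bot_iff_exists_ne_zero.1 hst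
    have hk0 : k ≠ 0 := fun h => hk0' (Subtype.ext h)
    rw [mem_coset_iff]
    refine mem_setStab_of_vadd_eq ((h (z - a)).resolve_right fun h1 => hk0 ?_)
    have h2 : z = k + z := (Set.ncard_le_one_iff (Set.toFinite _)).1 h1
      ⟨hz, a, ha, by simp⟩ ⟨(hk z).2 hz, k + a, (hk a).2 ha, by
        simp only [vadd_eq_add]; abel⟩
    simpa using h2

theorem ncard_coset_add [Finite G] (M : AddSubgroup G) (a : G) (B : Set G) :
    ((a +ᵥ (M : Set G)) + B).ncard = (B + (M : Set G)).ncard := by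
  rw [add_comm, add_vadd_set_eq, Set.ncard_vadd_set]

/-- A generating Sidon set with at least three elements expands. -/
theorem IsSidon.false_of_ncard_add_le [Finite G] {A X : Set G} (h : IsSidon A) (h0 : (0 : G) ∈ A)
    (hgen : AddSubgroup.closure A = ⊤) (hA : 3 ≤ A.ncard) (hX : 2 ≤ X.ncard)
    (hXA : (X + A).ncard + 2 ≤ Nat.card G) (hsmall : (X + A).ncard + 1 ≤ X.ncard + A.ncard) :
    False := by
  obtain ⟨Z, hZ, hZA, hsmall, hd⟩ := exists_atom ⟨0, h0⟩ hX hXA hsmall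
  have hZ0 : Z.Nonempty := (Set.ncard_pos).1 (by omega)
  obtain ⟨z, hz, z', hz', hzz⟩ := (Set.one_lt_ncard_iff (Set.toFinite _)).1 (show 1 < Z.ncard by omega) |>.imp
    fun z ⟨z', hz, hz', h⟩ => (⟨hz, z', hz', h⟩ : z ∈ Z ∧ ∃ z' ∈ Z, z ≠ z')
  have h2 := h.two_mul_ncard_le hz hz' hzz
  rcases isSidon_or_eq_coset hZ0 hd with hS | ⟨M, a, hM, rfl⟩
  · rw [add_comm A] at h2
    have h3 := hS.three_mul_ncard_le hA
    by_cases hZ3 : 3 ≤ Z.ncard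
    · have h4 := h.three_mul_ncard_le hZ3
      rw [add_comm A] at h4
      omega
    · omega
  · rw [add_comm A] at h2
    rw [ncard_coset_add] at *
    rw [ncard_coset] at *
    have h3 : ∃ b ∈ A, b ∉ M := by
      by_contra! hb
      have h4 : M = ⊤ := by
        rw [eq_top_iff, ← hgen, AddSubgroup.closure_le]
        exact hb
      have h5 := Set.ncard_le_ncard (vadd_subset_add (A := (M : Set G)) h0)
      rw [ncard_coset, add_comm] at h5
      have h6 : Nat.card M = Nat.card G := by
        rw [h4]
        simp
      omega
    obtain ⟨b, hb, hbM⟩ := h3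
    have h4 := disjoint_coset (K := M) (a := b) (b := 0) (by simpa using hbM)
    have h5 := Set.ncard_union_eq h4
    have h6 := Set.ncard_le_ncard (Set.union_subset (vadd_subset_add (A := (M : Set G)) hb)
      (vadd_subset_add h0))
    rw [ncard_coset, ncard_coset] at h5
    rw [add_comm] at h6
    omega

end

section
open scoped Pointwise Classical

variable {G : Type*} [AddCommGroup G]

theorem closure_le_setStab_of_ncard_le [Finite G] {A B : Set G} (h0 : (0 : G) ∈ A)
    (h : (A + B).ncard ≤ B.ncard) : AddSubgroup.closure A ≤ setStab B := by
  have h1 : B = A + B :=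
    Set.eq_of_subset_of_ncard_le (fun b hb => ⟨0, h0, b, hb, zero_add b⟩) h
  rw [AddSubgroup.closure_le]
  intro a ha
  refine mem_setStab_of_forall fun b hb => ?_
  rw [h1]
  exact Set.add_mem_add ha hb

theorem eq_univ_of_setStab_eq_top {B : Set G} (hB : B.Nonempty) (h : setStab B = ⊤) :
    B = Set.univ := by
  obtain ⟨b, hb⟩ := hB
  refine Set.eq_univ_of_forall fun x => ?_
  exact mem_of_sub_mem (K := ⊤) h.ge hb (AddSubgroup.mem_top _)

theorem ncard_add_ncard_le_of_notMem [Finite G] {A B : Set G} {y : G} (hy : y ∉ A + B) :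
    A.ncard + B.ncard ≤ Nat.card G := by
  have h1 : y +ᵥ (-A) ⊆ Bᶜ := by
    rintro _ ⟨a, ha, rfl⟩ hb
    exact hy ⟨-a, ha, _, hb, by simp⟩
  have h2 := Set.ncard_le_ncard h1
  have h3 := Set.ncard_add_ncard_compl B
  rw [Set.ncard_vadd_set, Set.ncard_neg] at h2
  omega

theorem IsSidon.ncard_add_ncard_le [Finite G] {A B : Set G} (h : IsSidon A) (h0 : (0 : G) ∈ A)
    (hgen : AddSubgroup.closure A = ⊤) (hA : 2 ≤ A.ncard) (hB : B.Nonempty)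
    (hAB : A + B ≠ Set.univ) : A.ncard + B.ncard ≤ (A + B).ncard + 1 := by
  by_contra! hlt
  obtain ⟨y, hy⟩ := (Set.ne_univ_iff_exists_notMem _).1 hAB
  have h1 := ncard_add_ncard_le_of_notMem hy
  by_cases hA3 : 3 ≤ A.ncard
  · by_cases hB2 : 2 ≤ B.ncard
    · have h2 := congrArg Set.ncard (add_comm A B)
      exact h.false_of_ncard_add_le h0 hgen hA3 hB2 (by omega) (by omega)
    · have h2 := ncard_le_ncard_add_left hB A
      rw [add_comm] at h2
      omega
  · have h2 := closure_le_setStab_of_ncard_le h0 (show (A + B).ncard ≤ B.ncard by omega)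
    rw [hgen] at h2
    have h3 := eq_univ_of_setStab_eq_top hB (top_le_iff.1 h2)
    have h4 := Set.ncard_univ G
    rw [← h3] at h4
    omega

theorem IsSidon.ncard_add_ncard_le_of_subset_coset [Finite G] {A B : Set G} (h : IsSidon A)
    (h0 : (0 : G) ∈ A) (hA : 2 ≤ A.ncard) (hB : B.Nonempty) {y : G}
    (hBy : B ⊆ y +ᵥ (AddSubgroup.closure A : Set G)) (hy : y ∉ A + B) :
    A.ncard + B.ncard ≤ (A + B).ncard + 1 := by
  set M := AddSubgroup.closure A with hM
  have hinj : Function.Injective (M.subtype) := M.subtype_injective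
  set A₁ : Set M := M.subtype ⁻¹' A with hA₁
  set B₁ : Set M := M.subtype ⁻¹' (-y +ᵥ B) with hB₁
  have hAA : M.subtype '' A₁ = A := by
    rw [Set.image_preimage_eq_iff]
    intro a ha
    exact ⟨⟨a, AddSubgroup.subset_closure ha⟩, rfl⟩
  have hBB : M.subtype '' B₁ = -y +ᵥ B := by
    rw [Set.image_preimage_eq_iff]
    rintro _ ⟨b, hb, rfl⟩
    refine ⟨⟨-y + b, ?_⟩, rfl⟩
    have := mem_coset_iff.1 (hBy hb)
    rwa [neg_add_eq_sub]
  have hAB : M.subtype '' (A₁ + B₁) = -y +ᵥ (A + B) := by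
    rw [Set.image_add, hAA, hBB, add_vadd_set_eq]
  have h1 : A.ncard = A₁.ncard := by
    rw [← hAA, Set.ncard_image_of_injective _ hinj]
  have h2 : B.ncard = B₁.ncard := by
    rw [← Set.ncard_image_of_injective B₁ hinj, hBB, Set.ncard_vadd_set]
  have h3 : (A + B).ncard = (A₁ + B₁).ncard := by
    rw [← Set.ncard_image_of_injective (A₁ + B₁) hinj, hAB, Set.ncard_vadd_set]
  rw [h1, h2, h3]
  refine IsSidon.ncard_add_ncard_le ?_ h0 ?_ (h1 ▸ hA) ?_ ?_
  · intro d hd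
    rw [← Set.ncard_image_of_injective _ hinj, Set.image_inter hinj]
    have : M.subtype '' (d +ᵥ A₁) = (d : G) +ᵥ A := by
      rw [← hAA]
      exact Set.image_vadd_distrib M.subtype d A₁
    rw [this, hAA]
    exact h _ fun h => hd (Subtype.ext h)
  · exact AddSubgroup.closure_closure_coe_preimage
  · rw [← Set.ncard_pos, ← h2]
    exact (Set.ncard_pos).2 hB
  · intro huniv
    apply hy
    have h4 : M.subtype 0 ∈ -y +ᵥ (A + B) := by
      rw [← hAB, huniv]
      exact ⟨0, trivial, rfl⟩
    rw [Set.mem_vadd_set_iff_neg_vadd_mem] at h4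
    simpa using h4

/-- A Vosper-type theorem in groups without a generating element: a set admitting a small sumset
is almost periodic. -/
theorem exists_ncard_add_subgroup_le [Finite G] (hcyc : ∀ a : G, AddSubgroup.zmultiples a ≠ ⊤)
    {B X : Set G} (hB : 2 ≤ B.ncard) (hX : 2 ≤ X.ncard) (hXB : (X + B).ncard + 2 ≤ Nat.card G)
    (hsmall : (X + B).ncard + 1 ≤ X.ncard + B.ncard) :
    ∃ M : AddSubgroup G, M ≠ ⊥ ∧ M ≠ ⊤ ∧
      (B + (M : Set G)).ncard + 1 ≤ B.ncard + Nat.card M := by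
  have hB0 : B.Nonempty := (Set.ncard_pos).1 (by omega)
  obtain ⟨A, hA, hAB, hsmall, hd⟩ := exists_atom hB0 hX hXB hsmall
  have hA0 : A.Nonempty := (Set.ncard_pos).1 (by omega)
  rcases isSidon_or_eq_coset hA0 hd with hS | ⟨M, a, hM, rfl⟩
  · clear hd
    wlog h0 : (0 : G) ∈ A generalizing A
    · obtain ⟨a, ha⟩ := hA0
      have h1 : ((-a +ᵥ A) + B).ncard = (A + B).ncard := by
        rw [add_comm, add_vadd_set_eq, Set.ncard_vadd_set, add_comm]
      exact this (-a +ᵥ A) (by rwa [Set.ncard_vadd_set]) (by rwa [h1])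
        (by rwa [h1, Set.ncard_vadd_set]) ⟨_, a, ha, rfl⟩ (hS.vadd _) ⟨a, ha, by simp⟩
    refine ⟨AddSubgroup.closure A, ?_, ?_, ?_⟩
    · intro h
      rw [AddSubgroup.closure_eq_bot_iff] at h
      have := Set.ncard_le_ncard h
      rw [Set.ncard_singleton] at this
      omega
    · intro h
      by_cases hA3 : 3 ≤ A.ncard
      · have h1 := congrArg Set.ncard (add_comm A B)
        exact hS.false_of_ncard_add_le h0 h hA3 hB (by omega) (by omega)
      · obtain ⟨a, ha, ha0⟩ := Set.exists_ne_of_one_lt_ncard (show 1 < A.ncard by omega) 0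
        have h1 : ({0, a} : Set G) = A := by
          refine Set.eq_of_subset_of_ncard_le (by
            rintro x (rfl | rfl)
            exacts [h0, ha]) ?_
          rw [Set.ncard_pair ha0.symm]
          omega
        refine hcyc a ?_
        rw [eq_top_iff, ← h, ← h1, AddSubgroup.closure_le]
        rintro x (rfl | rfl)
        · exact zero_mem _
        · exact AddSubgroup.mem_zmultiples _
    · set M := AddSubgroup.closure A with hM
      have hAM : A ⊆ M := AddSubgroup.subset_closure
      have hAm : A.ncard ≤ Nat.card M := by
        have := Set.ncard_le_ncard hAM
        rwa [← Nat.card_coe_set_eq] at this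
      by_cases hfull : B + (M : Set G) ⊆ A + B
      · have := Set.ncard_le_ncard hfull
        omega
      obtain ⟨y, hy, hyAB⟩ := Set.not_subset.1 hfull
      set Q : Set G := y +ᵥ (M : Set G) with hQ
      have hBQ : (B ∩ Q).Nonempty := by
        obtain ⟨b, hb, hyb⟩ := mem_add_subgroup.1 hy
        refine ⟨b, hb, mem_coset_iff.2 ?_⟩
        rwa [← M.neg_mem_iff, neg_sub]
      have h1 := hS.ncard_add_ncard_le_of_subset_coset h0 hA hBQ (y := y) Set.inter_subset_right
        fun h => hyAB (Set.add_subset_add_left Set.inter_subset_left h)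
      have h2 : Disjoint (A + B ∩ Q) (A + B \ Q) := by
        rw [Set.disjoint_left]
        rintro _ ⟨a, ha, b, hb, rfl⟩ ⟨a', ha', b', hb', he⟩
        refine hb'.2 (mem_coset_iff.2 ?_)
        have h3 : b' - y = (b - y) + a - a' := by
          have : a' + b' = a + b := he
          rw [eq_sub_of_add_eq' this]
          abel
        rw [h3]
        exact M.sub_mem (M.add_mem (mem_coset_iff.1 hb.2) (hAM ha)) (hAM ha')
      have h3 := Set.ncard_union_eq h2
      rw [← Set.add_union, Set.inter_union_sdiff] at h3
      have h4 := Set.ncard_inter_add_ncard_sdiff_eq_ncard B Q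
      have h5 := closure_le_setStab_of_ncard_le h0 (show (A + B \ Q).ncard ≤ (B \ Q).ncard by omega)
      have h6 : B + (M : Set G) ⊆ (B \ Q) ∪ Q := by
        refine add_subgroup_subset ?_ (le_setStab_union h5 (le_setStab_coset le_rfl y))
        rw [Set.sdiff_union_self]
        exact Set.subset_union_left
      have h7 := (Set.ncard_le_ncard h6).trans (Set.ncard_union_le _ _)
      have h8 := (Set.ncard_pos).2 hBQ
      have h9 : Q.ncard = Nat.card M := ncard_coset M y
      omega
  · refine ⟨M, hM, ?_, ?_⟩
    · rintro rfl
      rw [ncard_coset_add] at hAB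
      have := ncard_le_ncard_add_left hB0 ((⊤ : AddSubgroup G) : Set G)
      simp at this hAB
      omega
    · rw [ncard_coset_add, ncard_coset] at hsmall
      omega

end

section
open scoped Pointwise Classical

universe u

section
variable {G : Type*} [AddCommGroup G]

/-- The iterated sumset `B + ⋯ + B` with `j` summands. -/
def iterSum (B : Set G) (j : ℕ) : Set G := ∑ _i ∈ Finset.range j, B

theorem iterSum_zero (B : Set G) : iterSum B 0 = 0 := rfl

theorem iterSum_succ (B : Set G) (j : ℕ) : iterSum B (j + 1) = iterSum B j + B :=
  Finset.sum_range_succ _ _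

theorem iterSum_one (B : Set G) : iterSum B 1 = B := Finset.sum_range_one _

theorem mem_iterSum {B : Set G} {j : ℕ} {x : G} :
    x ∈ iterSum B j ↔ ∃ T : Multiset G, Multiset.card T = j ∧ (∀ t ∈ T, t ∈ B) ∧ T.sum = x := by
  induction j generalizing x with
  | zero =>
    rw [iterSum_zero]
    constructor
    · intro h
      exact ⟨0, rfl, by simp, (Set.mem_zero.1 h).symm⟩
    · rintro ⟨T, hT, -, rfl⟩
      rw [Multiset.card_eq_zero.1 hT]
      rfl
  | succ j ih =>
    rw [iterSum_succ]
    constructor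
    · rintro ⟨y, hy, b, hb, rfl⟩
      obtain ⟨T, hT, hTB, rfl⟩ := ih.1 hy
      refine ⟨b ::ₘ T, by simp [hT], ?_, by simp [add_comm]⟩
      rintro t ht
      rcases Multiset.mem_cons.1 ht with rfl | ht
      exacts [hb, hTB t ht]
    · rintro ⟨T, hT, hTB, rfl⟩
      obtain ⟨b, hb⟩ := Multiset.card_pos_iff_exists_mem.1 (by omega : 0 < Multiset.card T)
      obtain ⟨U, rfl⟩ := Multiset.exists_cons_of_mem hb
      refine ⟨U.sum, ih.2 ⟨U, by simpa using hT, fun t ht => hTB t (by simp [ht]), rfl⟩, b,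
        hTB b (by simp), by simp [add_comm]⟩

theorem iterSum_add (B : Set G) (i j : ℕ) : iterSum B (i + j) = iterSum B i + iterSum B j := by
  induction j with
  | zero => rw [iterSum_zero, add_zero, add_zero]
  | succ j ih => rw [← add_assoc, iterSum_succ, iterSum_succ, ih, add_assoc]

theorem iterSum_mono {B : Set G} (h0 : (0 : G) ∈ B) : Monotone (iterSum B) := by
  refine monotone_nat_of_le_succ fun j x hx => ?_
  rw [iterSum_succ]
  exact ⟨x, hx, 0, h0, add_zero x⟩

theorem image_iterSum {L : Type*} [AddCommGroup L] (f : G →+ L) (B : Set G) (j : ℕ) :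
    f '' iterSum B j = iterSum (f '' B) j := by
  induction j with
  | zero => rw [iterSum_zero, iterSum_zero, Set.image_zero, map_zero, Set.singleton_zero]
  | succ j ih => rw [iterSum_succ, iterSum_succ, Set.image_add, ih]

theorem nsmul_mem_iterSum {B : Set G} {b : G} (hb : b ∈ B) (j : ℕ) : j • b ∈ iterSum B j :=
  mem_iterSum.2 ⟨Multiset.replicate j b, by simp, fun t ht => by
    rwa [Multiset.eq_of_mem_replicate ht], by simp⟩

/-- Growth of iterated sumsets of a generating set containing zero. -/
theorem succ_le_ncard_iterSum [Finite G] {B : Set G} (h0 : (0 : G) ∈ B)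
    (hgen : AddSubgroup.closure B = ⊤) {n : ℕ} (hn : iterSum B n ≠ Set.univ) :
    ∀ j ≤ n, j + 1 ≤ (iterSum B j).ncard := by
  intro j
  induction j with
  | zero => simp [iterSum_zero, ← Set.singleton_zero]
  | succ j ih =>
    intro hj
    have h1 := ih (by omega)
    by_contra! hlt
    have h2 := closure_le_setStab_of_ncard_le h0 (B := iterSum B j) (by
      rw [add_comm, ← iterSum_succ]
      omega)
    rw [hgen] at h2
    have h3 := eq_univ_of_setStab_eq_top ((Set.ncard_pos).1 (by omega)) (top_le_iff.1 h2)
    exact hn (Set.eq_univ_of_univ_subset (h3 ▸ iterSum_mono h0 (by omega)))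

theorem coset_subset_add_of_card_lt [Finite G] {C D : Set G} {M : AddSubgroup G} {a a' : G}
    (hC : C ⊆ a +ᵥ (M : Set G)) (hD : D ⊆ a' +ᵥ (M : Set G)) (h : Nat.card M < C.ncard + D.ncard) :
    (a + a') +ᵥ (M : Set G) ⊆ C + D := by
  intro y hy
  by_contra hyCD
  have h1 : Disjoint C (y +ᵥ (-D)) := by
    rw [Set.disjoint_left]
    rintro c hc ⟨d, hd, rfl⟩
    exact hyCD ⟨y + d, hc, -d, hd, by simp⟩
  have h2 : C ∪ (y +ᵥ (-D)) ⊆ a +ᵥ (M : Set G) := by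
    refine Set.union_subset hC ?_
    rintro _ ⟨d, hd, rfl⟩
    rw [mem_coset_iff] at hy ⊢
    have h3 := mem_coset_iff.1 (hD hd)
    have h4 : y + d - a = (y - (a + a')) - (-d - a') := by abel
    exact h4 ▸ M.sub_mem hy h3
  have h5 := Set.ncard_le_ncard h2
  rw [Set.ncard_union_eq h1, Set.ncard_vadd_set, Set.ncard_neg, ncard_coset] at h5
  omega

theorem card_lt_ncard_inter_add_ncard_inter [Finite G] {B : Set G} {M : AddSubgroup G} {b b' : G}
    (hBM : (B + (M : Set G)).ncard + 1 ≤ B.ncard + Nat.card M) (hb : b ∈ B) (hb' : b' ∈ B)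
    (hbb : b - b' ∉ M) :
    Nat.card M < (B ∩ (b +ᵥ (M : Set G))).ncard + (B ∩ (b' +ᵥ (M : Set G))).ncard := by
  have h1 := disjoint_coset hbb
  have h2 : (b +ᵥ (M : Set G)) ∪ (b' +ᵥ (M : Set G)) ⊆ B + (M : Set G) := by
    rw [add_comm]
    exact Set.union_subset (vadd_subset_add hb) (vadd_subset_add hb')
  have h3 := Set.ncard_union_eq h1
  have h4 := Set.ncard_union_eq (h1.mono (Set.inter_subset_right (s := B))
    (Set.inter_subset_right (s := B)))
  rw [← Set.inter_union_distrib_left] at h4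
  have h5 := Set.ncard_inter_add_ncard_sdiff_eq_ncard B ((b +ᵥ (M : Set G)) ∪ (b' +ᵥ (M : Set G)))
  have h6 : (B \ ((b +ᵥ (M : Set G)) ∪ (b' +ᵥ (M : Set G)))) ∪
      ((b +ᵥ (M : Set G)) ∪ (b' +ᵥ (M : Set G))) ⊆ B + (M : Set G) :=
    Set.union_subset (Set.sdiff_subset.trans (subset_add_subgroup _ _)) h2
  have h7 := Set.ncard_le_ncard h6
  rw [Set.ncard_union_eq Set.disjoint_sdiff_left] at h7
  rw [ncard_coset, ncard_coset] at h3
  omega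

/-- Lifting fullness of an iterated sumset from a quotient by an almost-period. -/
theorem iterSum_eq_univ_of_quotient [Finite G] {B : Set G} {M : AddSubgroup G} {n : ℕ} (hn2 : 2 ≤ n)
    (hexp : AddMonoid.exponent G ≤ n) (h0 : (0 : G) ∈ B) (hgen : AddSubgroup.closure B = ⊤)
    (hM : M ≠ ⊤) (hBM : (B + (M : Set G)).ncard + 1 ≤ B.ncard + Nat.card M)
    (hquot : iterSum B n + (M : Set G) = Set.univ) : iterSum B n = Set.univ := by
  have key : ∀ g c c' u : G, u ∈ iterSum B (n - 2) →
      Nat.card M < (B ∩ (c +ᵥ (M : Set G))).ncard + (B ∩ (c' +ᵥ (M : Set G))).ncard →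
      g - (c + c' + u) ∈ M → g ∈ iterSum B n := by
    intro g c c' u hu hcc hg
    have h1 := coset_subset_add_of_card_lt (Set.inter_subset_right (s := B))
      (Set.inter_subset_right (s := B)) hcc
    have h2 : g - u ∈ (c + c') +ᵥ (M : Set G) := by
      rw [mem_coset_iff, sub_sub, add_comm u]
      exact hg
    have h3 := Set.add_subset_add Set.inter_subset_left Set.inter_subset_left (h1 h2)
    have h4 : n = n - 2 + 1 + 1 := by omega
    rw [h4, iterSum_succ, iterSum_succ, add_assoc]
    exact ⟨u, hu, g - u, h3, by simp⟩
  have hpair : ∀ b ∈ B, ∀ b' ∈ B, b - b' ∉ M →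
      Nat.card M < (B ∩ (b +ᵥ (M : Set G))).ncard + (B ∩ (b' +ᵥ (M : Set G))).ncard :=
    fun b hb b' hb' => card_lt_ncard_inter_add_ncard_inter hBM hb hb'
  refine Set.eq_univ_of_forall fun g => ?_
  obtain ⟨x, hx, hgx⟩ := mem_add_subgroup.1 (hquot ▸ Set.mem_univ g : g ∈ iterSum B n + (M : Set G))
  obtain ⟨T, hT, hTB, rfl⟩ := mem_iterSum.1 hx
  obtain ⟨b, hb⟩ := Multiset.card_pos_iff_exists_mem.1 (by omega : 0 < Multiset.card T)
  have hbB := hTB b hb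
  by_cases hsame : ∀ b' ∈ T, b' - b ∈ M
  · have h1 : T.sum - n • b ∈ M := by
      rw [← quotient_mk_eq_iff, quotient_mk_sum_of_forall (q := (QuotientAddGroup.mk b : G ⧸ M))
        (fun y hy => quotient_mk_eq_iff.2 (hsame y hy)), hT]
      rfl
    have hg : g - n • b ∈ M := by
      have := M.add_mem hgx h1
      rwa [sub_add_sub_cancel] at this
    obtain ⟨b', hb', hbb⟩ : ∃ b' ∈ B, b - b' ∉ M := by
      by_contra! hall
      refine hM (eq_top_iff.2 ?_)
      rw [← hgen, AddSubgroup.closure_le]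
      intro b' hb'
      have h2 := M.sub_mem (hall 0 h0) (hall b' hb')
      simpa using h2
    have hlt := hpair b hbB b' hb' hbb
    have hpos : 0 < AddMonoid.exponent G :=
      Nat.pos_of_ne_zero AddMonoid.exponent_ne_zero_of_finite
    have hb0 := AddMonoid.exponent_nsmul_eq_zero b
    have hb0' := AddMonoid.exponent_nsmul_eq_zero b'
    set e := AddMonoid.exponent G with he
    rcases hexp.lt_or_eq with hlt' | heq
    · refine key g b b' ((n - e - 1) • b + (e - 1) • b') ?_ hlt ?_
      · have h3 : n - 2 = (n - e - 1) + (e - 1) := by omega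
        rw [h3, iterSum_add]
        exact Set.add_mem_add (nsmul_mem_iterSum hbB _) (nsmul_mem_iterSum hb' _)
      · convert hg using 2
        have h4 : n = (n - e - 1) + 1 + e := by omega
        have h5 : e = (e - 1) + 1 := by omega
        have h6 : n • b = (n - e - 1) • b + b := by
          conv_lhs => rw [h4]
          rw [add_nsmul, add_nsmul, hb0, one_nsmul, add_zero]
        have h7 : (e - 1) • b' + b' = 0 := by
          rw [← succ_nsmul, ← h5, hb0']
        rw [h6, eq_comm, ← add_zero ((n - e - 1) • b + b), ← h7]
        abel
    · rw [heq] at hb0 hb0'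
      have hfin : ∀ p ∈ B, n • p = 0 →
          Nat.card M < (B ∩ (p +ᵥ (M : Set G))).ncard + (B ∩ (p +ᵥ (M : Set G))).ncard →
          g ∈ iterSum B n := by
        intro p hp hp0 hpp
        refine key g p p ((n - 2) • p) (nsmul_mem_iterSum hp _) hpp ?_
        have h3 : p + p + (n - 2) • p = n • p := by
          rw [← two_nsmul, ← add_nsmul]
          congr 1
          omega
        rw [h3, hp0, ← hb0]
        exact hg
      by_cases h3 : Nat.card M < (B ∩ (b +ᵥ (M : Set G))).ncard + (B ∩ (b +ᵥ (M : Set G))).ncard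
      · exact hfin b hbB hb0 h3
      · exact hfin b' hb' hb0' (by omega)
  · push Not at hsame
    obtain ⟨b', hb', hbb⟩ := hsame
    obtain ⟨U, rfl⟩ := Multiset.exists_cons_of_mem hb
    have hbU : b' ∈ U := by
      rcases Multiset.mem_cons.1 hb' with rfl | h
      · simp at hbb
      · exact h
    obtain ⟨V, rfl⟩ := Multiset.exists_cons_of_mem hbU
    refine key g b' b V.sum (mem_iterSum.2 ⟨V, ?_, fun t ht => hTB t (by simp [ht]), rfl⟩)
      (hpair b' (hTB b' (by simp)) b hbB hbb) ?_
    · simp at hT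
      omega
    · convert hgx using 2
      simp only [Multiset.sum_cons]
      abel

end

/-- A generating set `B` containing zero with `|G| < n |B|` and `exp G ≤ n` satisfies `n B = G`. -/
theorem iterSum_eq_univ (N : ℕ) : ∀ (G : Type u) [AddCommGroup G] [Finite G] (B : Set G) (n : ℕ),
    Nat.card G = N → (0 : G) ∈ B → AddSubgroup.closure B = ⊤ → AddMonoid.exponent G ≤ n →
    Nat.card G + 1 ≤ n * B.ncard → iterSum B n = Set.univ := by
  induction N using Nat.strong_induction_on with
  | _ N ih =>
    intro G _ _ B n hN h0 hgen hexp hcard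
    by_contra hne
    have hgrow := succ_le_ncard_iterSum h0 hgen hne
    obtain ⟨g, hg⟩ := (Set.ne_univ_iff_exists_notMem _).1 hne
    have hbig : n + 2 ≤ Nat.card G := by
      have h1 := hgrow n le_rfl
      have h2 := Set.ncard_lt_card hne
      omega
    have hcyc : ∀ a : G, AddSubgroup.zmultiples a ≠ ⊤ := by
      intro a ha
      have h1 := Nat.card_zmultiples a
      rw [ha, AddSubgroup.card_top] at h1
      have h2 := Nat.le_of_dvd (Nat.pos_of_ne_zero AddMonoid.exponent_ne_zero_of_finite)
        (AddMonoid.addOrder_dvd_exponent a)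
      omega
    set r := B.ncard with hr
    have hr2 : 2 ≤ r := by
      by_contra! h
      have := Nat.mul_le_mul_left n (show r ≤ 1 by omega)
      omega
    have hrl : r ≤ Nat.card G := by
      have := Set.ncard_le_card B
      omega
    have hn2 : 2 ≤ n := by
      by_contra! h
      interval_cases n
      · omega
      · omega
    obtain ⟨n, rfl⟩ : ∃ k, n = k + 1 := ⟨n - 1, by omega⟩
    have hlast : (iterSum B n).ncard + r ≤ Nat.card G := by
      rw [iterSum_succ] at hg
      exact ncard_add_ncard_le_of_notMem hg
    obtain ⟨j, hj1, hjn, hj⟩ : ∃ j, 1 ≤ j ∧ j + 1 ≤ n ∧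
        (iterSum B (j + 1)).ncard < (iterSum B j).ncard + r := by
      by_contra! hall
      have h1 : ∀ j, 1 ≤ j → j ≤ n → j * r ≤ (iterSum B j).ncard := by
        intro j hj
        induction j, hj using Nat.le_induction with
        | base => simp [iterSum_one, hr]
        | succ j hj ihj =>
          intro hjn
          have h2 := ihj (by omega)
          have h3 := hall j hj hjn
          rw [add_mul, one_mul]
          omega
      have h2 := h1 n (by omega) le_rfl
      rw [add_mul, one_mul] at hcard
      omega
    have hmono := Set.ncard_le_ncard (iterSum_mono h0 hjn)
    have hj2 := hgrow j (by omega)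
    rw [iterSum_succ] at hj hmono
    obtain ⟨M, hM0, hM1, hBM⟩ := exists_ncard_add_subgroup_le hcyc (B := B) (X := iterSum B j)
      hr2 (by omega) (by omega) (by omega)
    refine hne (iterSum_eq_univ_of_quotient hn2 hexp h0 hgen hM1 hBM ?_)
    have hcardM := AddSubgroup.card_eq_card_quotient_mul_card_addSubgroup M
    have hMpos : 1 < Nat.card M := (AddSubgroup.one_lt_card_iff_ne_bot M).2 hM0
    have hqpos : 0 < Nat.card (G ⧸ M) := Nat.card_pos
    have h1 := ih (Nat.card (G ⧸ M)) (by rw [← hN, hcardM]; nlinarith) (G ⧸ M)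
      (QuotientAddGroup.mk' M '' B) (n + 1) rfl ⟨0, h0, rfl⟩ ?_ ?_ ?_
    · rw [← preimage_image_quotient_mk]
      have h2 := image_iterSum (QuotientAddGroup.mk' M) B (n + 1)
      rw [h1] at h2
      have h3 : (QuotientAddGroup.mk : G → G ⧸ M) '' iterSum B (n + 1) = Set.univ := h2
      rw [h3, Set.preimage_univ]
    · rw [← AddMonoidHom.map_closure, hgen,
        AddSubgroup.map_top_of_surjective _ (QuotientAddGroup.mk'_surjective M)]
    · exact (Nat.le_of_dvd (Nat.pos_of_ne_zero AddMonoid.exponent_ne_zero_of_finite)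
        (AddGroup.exponent_quotient_dvd M)).trans hexp
    · have h2 := ncard_add_subgroup_eq M B
      have h3 : r ≤ (B + (M : Set G)).ncard := Set.ncard_le_ncard (subset_add_subgroup B M)
      have h4 : QuotientAddGroup.mk' M '' B = (QuotientAddGroup.mk : G → G ⧸ M) '' B := rfl
      rw [h4]
      by_contra! h5
      have h6 : (n + 1) * ((QuotientAddGroup.mk : G → G ⧸ M) '' B).ncard ≤ Nat.card (G ⧸ M) := by
        omega
      have h7 := Nat.mul_le_mul_left (Nat.card M) h6
      have h8 := Nat.mul_le_mul_left (n + 1) h3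
      rw [h2] at h8
      rw [mul_comm (Nat.card M) (Nat.card (G ⧸ M)), ← hcardM] at h7
      rw [mul_left_comm] at h8
      omega

end

section
open scoped Pointwise Classical

variable {G : Type*} [AddCommGroup G]

theorem exists_le_sum_eq_of_mem_finsetSum {ι : Type*} (s : Finset ι) (f : ι → G) {x : G}
    (hx : x ∈ ∑ i ∈ s, ({0, f i} : Set G)) : ∃ T ≤ s.val.map f, T.sum = x := by
  induction s using Finset.induction_on generalizing x with
  | empty => exact ⟨0, le_rfl, (Set.mem_zero.1 (by simpa using hx)).symm⟩
  | insert i s hi ih =>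
    rw [Finset.sum_insert hi] at hx
    obtain ⟨a, ha, y, hy, rfl⟩ := hx
    obtain ⟨T, hT, rfl⟩ := ih hy
    rw [Finset.insert_val_of_notMem hi, Multiset.map_cons]
    rcases ha with rfl | rfl
    · exact ⟨T, hT.trans (Multiset.le_cons_self _ _), (zero_add _).symm⟩
    · exact ⟨f i ::ₘ T, Multiset.cons_le_cons _ hT, Multiset.sum_cons _ _⟩

theorem ncard_pair_add_subgroup [Finite G] (H : AddSubgroup G) (a : G) :
    (({0, a} : Set G) + (H : Set G)).ncard = Nat.card H + if a ∉ H then Nat.card H else 0 := by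
  have h1 : ({0, a} : Set G) + (H : Set G) = ((0 : G) +ᵥ (H : Set G)) ∪ (a +ᵥ (H : Set G)) := by
    ext x
    rw [mem_add_subgroup, Set.mem_union, mem_coset_iff, mem_coset_iff]
    simp
  rw [h1]
  split_ifs with ha
  · rw [coset_eq_coset (K := H) (a := 0) (b := a) (by simpa using ha), Set.union_self, ncard_coset,
      add_zero]
  · rw [Set.ncard_union_eq (disjoint_coset (by simpa using ha)), ncard_coset, ncard_coset]

/-- If enough terms lie outside each proper subgroup, the subset sums cover the whole group. -/
theorem exists_le_sum_eq [Finite G] {E : Multiset G}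
    (hE : ∀ H : AddSubgroup G, H ≠ ⊤ →
      Nat.card (G ⧸ H) - 1 ≤ Multiset.card (E.filter fun x => x ∉ H)) (z : G) :
    ∃ T ≤ E, T.sum = z := by
  obtain ⟨k, f, rfl⟩ : ∃ (k : ℕ) (f : Fin k → G), E = Finset.univ.val.map f :=
    ⟨E.toList.length, E.toList.get, by rw [Fin.univ_val_map, List.ofFn_get, Multiset.coe_toList]⟩
  refine exists_le_sum_eq_of_mem_finsetSum Finset.univ f ?_
  set X : Set G := ∑ i, ({0, f i} : Set G) with hX
  have hne : ∀ i ∈ Finset.univ, ({0, f i} : Set G).Nonempty := fun i _ => Set.insert_nonempty _ _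
  have hXne : X.Nonempty := finsetSum_nonempty hne
  suffices h : X = Set.univ from h ▸ Set.mem_univ z
  by_cases htop : setStab X = ⊤
  · exact eq_univ_of_setStab_eq_top hXne htop
  have h1 := kneser_sum Finset.univ (fun i => ({0, f i} : Set G)) hne (setStab X)
    (by rw [← hX, add_setStab])
  rw [← hX, add_setStab] at h1
  have h2 := hE _ htop
  have h3 : Multiset.card ((Finset.univ.val.map f).filter fun x => x ∉ setStab X) =
      ∑ i, if f i ∉ setStab X then 1 else 0 := by
    rw [← Multiset.countP_eq_card_filter, Multiset.countP_map, ← Finset.card_filter]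
    rfl
  have h4 : ∑ i, (({0, f i} : Set G) + (setStab X : Set G)).ncard =
      k * Nat.card (setStab X) +
        (∑ i, if f i ∉ setStab X then 1 else 0) * Nat.card (setStab X) := by
    simp_rw [ncard_pair_add_subgroup]
    rw [Finset.sum_add_distrib, Finset.sum_mul]
    simp
  rw [← h3] at h4
  simp only [Finset.card_univ, Fintype.card_fin] at h1
  have h5 := AddSubgroup.card_eq_card_quotient_mul_card_addSubgroup (setStab X)
  refine Set.eq_of_subset_of_ncard_le (Set.subset_univ _) ?_
  rw [Set.ncard_univ]
  have h6 : 0 < Nat.card (G ⧸ setStab X) := Nat.card_pos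
  have h7 := Nat.mul_le_mul_right (Nat.card (setStab X)) (Nat.sub_le_iff_le_add.1 h2)
  rw [add_mul] at h7
  omega

theorem exists_lt_sum_eq [Finite G] {T : Multiset G} (hT : Nat.card G ≤ Multiset.card T) :
    ∃ T' ≤ T, T'.sum = T.sum ∧ Multiset.card T' < Multiset.card T := by
  have := Fintype.ofFinite G
  induction T using Quotient.inductionOn with
  | _ l =>
    obtain ⟨i, j, hij, h⟩ := Fintype.exists_ne_map_eq_of_card_lt
      (fun i : Fin (l.length + 1) => (l.take i).sum) (by
        rw [Fintype.card_fin, ← Nat.card_eq_fintype_card]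
        exact Nat.lt_succ_of_le hT)
    wlog hlt : i < j generalizing i j
    · exact this j i hij.symm h.symm (lt_of_le_of_ne (not_lt.1 hlt) hij.symm)
    have hj := j.2
    have hlt' : (i : ℕ) < j := hlt
    refine ⟨(l.take i ++ l.drop j : List G), ?_, ?_, ?_⟩
    · refine Multiset.coe_le.2 (List.Sublist.subperm ?_)
      conv_rhs => rw [← List.take_append_drop (i : ℕ) l]
      exact (List.Sublist.refl _).append (List.drop_sublist_drop_left l hlt'.le)
    · change ((l.take i ++ l.drop j : List G) : Multiset G).sum = (l : Multiset G).sum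
      rw [Multiset.sum_coe, Multiset.sum_coe, List.sum_append, h, List.sum_take_add_sum_drop]
    · change (l.take i ++ l.drop j).length < l.length
      rw [List.length_append, List.length_take, List.length_drop]
      omega

theorem exists_le_sum_eq_card_lt [Finite G] {E : Multiset G}
    (hE : ∀ H : AddSubgroup G, H ≠ ⊤ →
      Nat.card (G ⧸ H) - 1 ≤ Multiset.card (E.filter fun x => x ∉ H)) (z : G) :
    ∃ T ≤ E, Multiset.card T < Nat.card G ∧ T.sum = z := by
  have hex : ∃ k, ∃ T ≤ E, Multiset.card T = k ∧ T.sum = z := by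
    obtain ⟨T, hT, hz⟩ := exists_le_sum_eq hE z
    exact ⟨_, T, hT, rfl, hz⟩
  obtain ⟨T, hT, hk, hz⟩ := Nat.find_spec hex
  refine ⟨T, hT, ?_, hz⟩
  by_contra! hle
  obtain ⟨T', hT', hs, hlt⟩ := exists_lt_sum_eq hle
  exact Nat.find_min hex (hk ▸ hlt) ⟨T', hT'.trans hT, rfl, hs.trans hz⟩

/-- The iterated sumset of a large set containing zero fills the subgroup it generates even after
dropping fewer summands than the index. -/
theorem coe_closure_subset_iterSum [Finite G] {B : Set G} {n c : ℕ} (h0 : (0 : G) ∈ B)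
    (hexp : AddMonoid.exponent G ≤ n) (hcard : Nat.card G + 1 ≤ n * B.ncard)
    (hc : Nat.card (G ⧸ AddSubgroup.closure B) = c) (hcn : c ≤ n) :
    (AddSubgroup.closure B : Set G) ⊆ iterSum B (n - (c - 1)) := by
  set M := AddSubgroup.closure B with hM
  have hl := AddSubgroup.card_eq_card_quotient_mul_card_addSubgroup M
  rw [hc] at hl
  have hcpos : 0 < c := hc ▸ Nat.card_pos
  rcases (show c = 1 ∨ 2 ≤ c by omega) with rfl | hc2
  · have hMtop : M = ⊤ := AddSubgroup.eq_top_of_card_eq M (by omega)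
    rw [Nat.sub_self, Nat.sub_zero, iterSum_eq_univ _ G B n rfl h0 hMtop hexp hcard]
    exact Set.subset_univ _
  obtain ⟨p, hp⟩ : ∃ p, n - (c - 1) = p + 1 := ⟨n - c, by omega⟩
  have hn : n = p + c := by omega
  rw [hp]
  have hBM : B ⊆ M := AddSubgroup.subset_closure
  have hsub : iterSum B (p + 1) ⊆ M := by
    intro x hx
    obtain ⟨T, -, hTB, rfl⟩ := mem_iterSum.1 hx
    exact M.multiset_sum_mem T fun t ht => hBM (hTB t ht)
  have h0' : (0 : G) ∈ iterSum B (p + 1) := by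
    have := nsmul_mem_iterSum h0 (p + 1)
    rwa [nsmul_zero] at this
  set K := setStab (iterSum B (p + 1)) with hK
  have hKM : K ≤ M := fun k hk => hsub (by simpa using (hk 0).2 h0')
  by_contra hne
  have hBK : ¬ B ⊆ K := by
    intro hBK
    refine hne fun x hx => ?_
    have h1 : M ≤ K := (AddSubgroup.closure_le K).2 hBK
    simpa using (h1 hx 0).2 h0'
  have h1 := kneser_sum (Finset.range (p + 1)) (fun _ => B) (fun _ _ => ⟨0, h0⟩) K
    (by change setStab (iterSum B (p + 1) + (K : Set G)) ≤ K; rw [add_setStab])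
  change _ ≤ (iterSum B (p + 1) + (K : Set G)).ncard + _ at h1
  rw [add_setStab, Finset.sum_const, Finset.card_range, smul_eq_mul, ncard_add_subgroup_eq] at h1
  set r := ((QuotientAddGroup.mk : G → G ⧸ K) '' B).ncard with hr
  have hKpos : 0 < Nat.card K := Nat.card_pos
  have h2 : (iterSum B (p + 1)).ncard + Nat.card K ≤ Nat.card M := by
    obtain ⟨y, hy, hy'⟩ := Set.not_subset.1 hne
    have h3 : K ≤ setStab ((M : Set G) \ iterSum B (p + 1)) :=
      le_setStab_sdiff (le_setStab_subgroup hKM) le_rfl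
    have h4 := Set.ncard_le_ncard (coset_subset h3 ⟨hy, hy'⟩)
    have h5 := Set.ncard_sdiff_add_ncard_of_subset hsub
    rw [ncard_coset] at h4
    have h6 : (M : Set G).ncard = Nat.card M := (Nat.card_coe_set_eq _).symm
    omega
  have hr2 : 2 ≤ r := by
    by_contra! hlt
    refine hBK ?_
    have h3 : (0 : G) +ᵥ (K : Set G) ⊆ B + (K : Set G) := by
      rw [add_comm]
      exact vadd_subset_add h0
    have h4 := Set.eq_of_subset_of_ncard_le h3 (by
      rw [ncard_add_subgroup_eq, ncard_coset, ← hr]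
      exact (Nat.mul_le_mul_left _ (show r ≤ 1 by omega)).trans (mul_one _).le)
    rw [zero_vadd] at h4
    rw [h4]
    exact subset_add_subgroup B K
  have h3 : B.ncard ≤ Nat.card K * r := by
    rw [hr, ← ncard_add_subgroup_eq]
    exact Set.ncard_le_ncard (subset_add_subgroup B K)
  obtain ⟨m, hm⟩ := AddSubgroup.card_dvd_of_le hKM
  rw [hm] at h2 hl
  obtain ⟨s, hs⟩ : ∃ s, r = s + 2 := ⟨r - 2, by omega⟩
  have h4 : (p + 1) * (s + 1) + 2 ≤ m := by
    refine Nat.le_of_mul_le_mul_left ?_ hKpos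
    rw [hs] at h1
    nlinarith
  have h5 : c * m < n * r := by
    refine Nat.lt_of_mul_lt_mul_left (a := Nat.card K) ?_
    have := Nat.mul_le_mul_left n h3
    rw [mul_left_comm] at this
    rw [mul_left_comm] at hl
    omega
  have h6 := Nat.mul_le_mul_left c h4
  obtain ⟨d, rfl⟩ : ∃ d, c = d + 2 := ⟨c - 2, by omega⟩
  rw [hn, hs] at h5
  have : 0 ≤ p * s * d := Nat.zero_le _
  nlinarith
end

section
open scoped Pointwise Classical

universe u

section
variable {G : Type*} [AddCommGroup G]

theorem filter_notMem_comap_mk (M : AddSubgroup G) (H : AddSubgroup (G ⧸ M)) (R : Multiset G) :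
    (R.map (QuotientAddGroup.mk : G → G ⧸ M)).filter (fun x => x ∉ H) =
      (R.filter fun x => x ∉ H.comap (QuotientAddGroup.mk' M)).map QuotientAddGroup.mk := by
  rw [Multiset.filter_map]
  rfl

theorem card_quotient_comap_mk (M : AddSubgroup G) (H : AddSubgroup (G ⧸ M)) :
    Nat.card (G ⧸ H.comap (QuotientAddGroup.mk' M)) = Nat.card ((G ⧸ M) ⧸ H) :=
  AddSubgroup.index_comap_of_surjective H (QuotientAddGroup.mk'_surjective M)

theorem comap_mk_ne_top {M : AddSubgroup G} {H : AddSubgroup (G ⧸ M)} (h : H ≠ ⊤) :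
    H.comap (QuotientAddGroup.mk' M) ≠ ⊤ := by
  intro h'
  refine h (eq_top_iff.2 fun x _ => ?_)
  obtain ⟨y, rfl⟩ := QuotientAddGroup.mk'_surjective M x
  have : y ∈ H.comap (QuotientAddGroup.mk' M) := h' ▸ AddSubgroup.mem_top y
  exact this

/-- Full sums from many high multiplicity terms, one of which is zero. -/
theorem subseqSums_eq_univ_of_zero_mem [Finite G] {R : Multiset G} {n : ℕ} {B : Set G}
    (hexp : AddMonoid.exponent G ≤ n) (hB : ∀ b ∈ B, n ≤ R.count b) (h0 : (0 : G) ∈ B)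
    (hcard : Nat.card G + 1 ≤ n * B.ncard)
    (hout : Multiset.card (R.filter fun x => x ∉ B) + n * B.ncard + 2 ≤ Nat.card G + n)
    (hcoset : ∀ H : AddSubgroup G, H ≠ ⊤ →
      Nat.card (G ⧸ H) - 1 ≤ Multiset.card (R.filter fun x => x ∉ H)) :
    subseqSums R n = Set.univ := by
  set M := AddSubgroup.closure B with hM
  have hBM : B ⊆ M := AddSubgroup.subset_closure
  set E := R.filter fun x => x ∉ M with hE
  have hpos : 0 < Nat.card (G ⧸ M) := Nat.card_pos
  have hEcard : Nat.card (G ⧸ M) - 1 ≤ Multiset.card E := by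
    by_cases hMtop : M = ⊤
    · have h1 : Nat.card (G ⧸ M) = 1 := by
        rw [hMtop]
        exact AddSubgroup.index_top
      omega
    · exact hcoset M hMtop
  have hEle : Multiset.card E ≤ Multiset.card (R.filter fun x => x ∉ B) :=
    Multiset.card_le_card (Multiset.monotone_filter_right R fun x hx hxB => hx (hBM hxB))
  have hle : Nat.card (G ⧸ M) ≤ n := by omega
  have hfull : (M : Set G) ⊆ iterSum B (n - (Nat.card (G ⧸ M) - 1)) :=
    coe_closure_subset_iterSum h0 hexp hcard rfl hle
  refine Set.eq_univ_of_forall fun z => ?_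
  obtain ⟨T, hT, hTc, hTz⟩ := exists_le_sum_eq_card_lt
    (E := E.map (QuotientAddGroup.mk : G → G ⧸ M)) (fun H hH => by
      rw [← card_quotient_comap_mk, filter_notMem_comap_mk, Multiset.card_map, hE,
        Multiset.filter_filter]
      refine (hcoset _ (comap_mk_ne_top hH)).trans (le_of_eq ?_)
      congr 1
      refine Multiset.filter_congr fun x _ => ⟨fun hx => ⟨hx, fun hxM => hx ?_⟩, fun hx => hx.1⟩
      have h1 : (QuotientAddGroup.mk' M x) = 0 := (QuotientAddGroup.eq_zero_iff x).2 hxM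
      rw [AddSubgroup.mem_comap, h1]
      exact H.zero_mem) (QuotientAddGroup.mk z)
  have h1 : (QuotientAddGroup.mk z : G ⧸ M) ∈
      QuotientAddGroup.mk' M '' subseqSums E (Multiset.card T) := by
    rw [← subseqSums_map]
    exact ⟨T, hT, rfl, hTz⟩
  obtain ⟨_, ⟨T', hT', hTT', rfl⟩, hTz'⟩ := h1
  have h2 : z - T'.sum ∈ M := quotient_mk_eq_iff.1 hTz'.symm
  have h3 := iterSum_mono h0 (show n - (Nat.card (G ⧸ M) - 1) ≤ n - Multiset.card T by omega)
    (hfull h2)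
  obtain ⟨U, hU, hUB, hUz⟩ := mem_iterSum.1 h3
  refine ⟨T' + U, ?_, ?_, ?_⟩
  · rw [Multiset.le_iff_count]
    intro x
    rw [Multiset.count_add]
    have h4 := Multiset.count_le_of_le x hT'
    rw [hE, Multiset.count_filter] at h4
    by_cases hxM : x ∈ M
    · rw [if_neg (not_not.2 hxM)] at h4
      by_cases hxB : x ∈ B
      · have h5 := hB x hxB
        have h6 := Multiset.count_le_card x U
        omega
      · have h5 : U.count x = 0 := Multiset.count_eq_zero.2 fun h => hxB (hUB x h)
        omega
    · have h5 : U.count x = 0 := Multiset.count_eq_zero.2 fun h => hxM (hBM (hUB x h))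
      rw [if_pos hxM] at h4
      omega
  · rw [Multiset.card_add, hTT', hU]
    omega
  · rw [Multiset.sum_add, hUz, add_sub_cancel]

theorem subseqSums_map_add_left (R : Multiset G) (n : ℕ) (c : G) :
    subseqSums (R.map (c + ·)) n = n • c +ᵥ subseqSums R n := by
  have h : ∀ T : Multiset G, (T.map (c + ·)).sum = Multiset.card T • c + T.sum := fun T => by
    rw [Multiset.sum_map_add, Multiset.map_const', Multiset.sum_replicate, Multiset.map_id']
  ext x
  constructor
  · rintro ⟨T, hT, rfl, rfl⟩
    refine ⟨(T.map (-c + ·)).sum, ⟨T.map (-c + ·), ?_, by simp, rfl⟩, ?_⟩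
    · have := Multiset.map_le_map (f := (-c + ·)) hT
      simpa using this
    · change Multiset.card T • c + (T.map (-c + ·)).sum = T.sum
      rw [Multiset.sum_map_add, Multiset.map_const', Multiset.sum_replicate, Multiset.map_id']
      simp
  · rintro ⟨_, ⟨T, hT, rfl, rfl⟩, rfl⟩
    exact ⟨T.map (c + ·), Multiset.map_le_map hT, by simp, h T⟩

theorem subseqSums_card_sub {S : Multiset G} {m n : ℕ} (h : Multiset.card S = m + n) :
    subseqSums S m = (fun x => S.sum - x) '' subseqSums S n := by
  ext x
  constructor
  · rintro ⟨T, hT, hTm, rfl⟩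
    obtain ⟨U, rfl⟩ := Multiset.le_iff_exists_add.1 hT
    rw [Multiset.card_add] at h
    exact ⟨U.sum, ⟨U, Multiset.le_add_left _ _, by omega, rfl⟩, by simp⟩
  · rintro ⟨_, ⟨T, hT, hTm, rfl⟩, rfl⟩
    obtain ⟨U, rfl⟩ := Multiset.le_iff_exists_add.1 hT
    rw [Multiset.card_add] at h
    exact ⟨U, Multiset.le_add_left _ _, by omega, by simp⟩

end

theorem subseqSums_eq_univ_of_setStab_eq_bot {G : Type u} [AddCommGroup G] [Fintype G]
    {R : Multiset G} {n t : ℕ} (hexp : AddMonoid.exponent G ≤ n) (ht : 0 < t)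
    (hlen : Multiset.card R = Nat.card G * t + n) (hmult : ∀ x, R.count x ≤ n * t)
    (hcoset : ∀ H : AddSubgroup G, H ≠ ⊤ → ∀ α : G,
      Nat.card (G ⧸ H) - 1 ≤ Multiset.card (R.filter fun x => x ∉ α +ᵥ (H : Set G)))
    (hst : setStab (subseqSums R n) = ⊥) : subseqSums R n = Set.univ := by
  by_contra hne
  have hnpos : 0 < n := (Nat.pos_of_ne_zero AddMonoid.exponent_ne_zero_of_finite).trans_le hexp
  have h1 := dgmBound _ G R n (by omega) hst le_rfl
  have h2 := Set.ncard_lt_card hne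
  set B : Finset G := Finset.univ.filter fun x => n ≤ R.count x with hB
  set e := Multiset.card (R.filter fun x => x ∉ (B : Set G)) with he
  have hsplit : ∀ f : G → ℕ, ∑ x, f x = ∑ x ∈ B, f x + ∑ x ∈ Finset.univ.filter (· ∉ B), f x := by
    intro f
    rw [← Finset.sum_filter_add_sum_filter_not Finset.univ (· ∈ B)]
    congr 2
    ext x
    simp
  have hesum : e = ∑ x ∈ Finset.univ.filter (· ∉ B), R.count x := by
    rw [he, ← Multiset.sum_count_eq_card (s := Finset.univ) (by simp), Finset.sum_filter]
    refine Finset.sum_congr rfl fun x _ => ?_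
    rw [Multiset.count_filter]
    rfl
  have hN : ∑ x, min n (R.count x) = n * B.card + e := by
    rw [hsplit, hesum, mul_comm, ← smul_eq_mul, ← Finset.sum_const]
    congr 1
    · refine Finset.sum_congr rfl fun x hx => ?_
      rw [hB, Finset.mem_filter] at hx
      exact min_eq_left hx.2
    · refine Finset.sum_congr rfl fun x hx => ?_
      rw [Finset.mem_filter, hB, Finset.mem_filter] at hx
      refine min_eq_right ?_
      by_contra! hlt
      exact hx.2 ⟨Finset.mem_univ _, hlt.le⟩
  have hR : Multiset.card R ≤ B.card * (n * t) + e := by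
    rw [← Multiset.sum_count_eq_card (s := Finset.univ) (m := R) (by simp), hsplit, ← hesum,
      ← smul_eq_mul, ← Finset.sum_const]
    exact Nat.add_le_add_right (Finset.sum_le_sum fun x _ => hmult x) _
  rw [hN] at h1
  have hcard : Nat.card G + 1 ≤ n * B.card := by
    by_contra! hlt
    obtain ⟨d, hd⟩ : ∃ d, Nat.card G = n * B.card + d := ⟨Nat.card G - n * B.card, by omega⟩
    have h3 : B.card * (n * t) = n * B.card * t := by ring
    have h4 : d * 1 ≤ d * t := Nat.mul_le_mul_left d ht
    rw [hlen, h3, hd, add_mul] at hR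
    omega
  obtain ⟨b, hb⟩ : B.Nonempty := by
    rw [← Finset.card_pos]
    by_contra! h
    have := Nat.mul_le_mul_left n h
    omega
  have hinj : Function.Injective (fun x : G => -b + x) := add_right_injective _
  have hcount : ∀ x, (R.map (-b + ·)).count x = R.count (b + x) := by
    intro x
    have := Multiset.count_map_eq_count' (fun x : G => -b + x) R hinj (b + x)
    rwa [neg_add_cancel_left] at this
  have h3 := subseqSums_eq_univ_of_zero_mem (R := R.map (-b + ·)) (n := n)
    (B := -b +ᵥ (B : Set G)) hexp ?_ ⟨b, hb, by simp⟩ ?_ ?_ ?_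
  · rw [subseqSums_map_add_left] at h3
    refine hne ?_
    have h4 := congrArg Set.ncard h3
    rw [Set.ncard_vadd_set, Set.ncard_univ] at h4
    omega
  · rintro _ ⟨x, hx, rfl⟩
    change n ≤ (R.map (-b + ·)).count (-b + x)
    rw [hcount, add_neg_cancel_left]
    exact (Finset.mem_filter.1 hx).2
  · rw [Set.ncard_vadd_set, Set.ncard_coe_finset]
    exact hcard
  · rw [Set.ncard_vadd_set, Set.ncard_coe_finset, Multiset.filter_map, Multiset.card_map]
    have h5 : (R.filter ((fun x => x ∉ -b +ᵥ (B : Set G)) ∘ (-b + ·))) =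
        R.filter fun x => x ∉ (B : Set G) := by
      refine Multiset.filter_congr fun x _ => not_congr ?_
      change -b +ᵥ x ∈ -b +ᵥ (B : Set G) ↔ x ∈ (B : Set G)
      exact Set.vadd_mem_vadd_set_iff
    rw [h5]
    omega
  · intro H hH
    rw [Multiset.filter_map, Multiset.card_map]
    convert hcoset H hH b using 3
    rw [mem_coset_iff, Function.comp_apply, neg_add_eq_sub]

end

open scoped Pointwise Classical in
theorem stmt_16 {G : Type*} [AddCommGroup G] [Fintype G]
    (n : ℕ) (hn : AddMonoid.exponent G ≤ n)
    (S : Multiset G)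
    (hlen : Multiset.card S = Nat.card G + n)
    (hmult : ∀ x : G, S.count x ≤ n)
    (hcoset : ∀ H : AddSubgroup G, H ≠ ⊤ → ∀ α : G,
      Nat.card (G ⧸ H) - 1 ≤
        Multiset.card (S.filter fun x => x ∉ α +ᵥ (H : Set G))) :
    subseqSums S (Nat.card G) = Set.univ := by
  suffices h : subseqSums S n = Set.univ by
    rw [subseqSums_card_sub hlen, h]
    refine Set.eq_univ_of_forall fun x => ⟨S.sum - x, trivial, ?_⟩
    exact sub_sub_cancel _ _
  set H := setStab (subseqSums S n) with hH
  have hmap : subseqSums (S.map (QuotientAddGroup.mk : G → G ⧸ H)) n =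
      (QuotientAddGroup.mk : G → G ⧸ H) '' subseqSums S n :=
    subseqSums_map (QuotientAddGroup.mk' H) S n
  have hst : setStab (subseqSums (S.map (QuotientAddGroup.mk : G → G ⧸ H)) n) = ⊥ := by
    rw [hmap]
    refine setStab_image_quotient_mk ?_
    rw [add_setStab]
  have hfull := subseqSums_eq_univ_of_setStab_eq_bot (G := G ⧸ H) (t := Nat.card H) (n := n)
    (R := S.map QuotientAddGroup.mk) ?_ Nat.card_pos ?_ ?_ ?_ hst
  · rw [hmap] at hfull
    have h1 := preimage_image_quotient_mk H (subseqSums S n)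
    rw [hfull, Set.preimage_univ, add_setStab] at h1
    exact h1.symm
  · exact (Nat.le_of_dvd (Nat.pos_of_ne_zero AddMonoid.exponent_ne_zero_of_finite)
      (AddGroup.exponent_quotient_dvd H)).trans hn
  · rw [Multiset.card_map, hlen, AddSubgroup.card_eq_card_quotient_mul_card_addSubgroup H]
  · intro q
    obtain ⟨x, rfl⟩ := QuotientAddGroup.mk_surjective q
    suffices h0 : cosetCount H S x ≤ n * Nat.card H by
      rw [cosetCount_eq_count_map] at h0
      convert h0
    have h1 := sum_ite_cosetCount (bot_le : ⊥ ≤ H) S x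
    rw [AddSubgroup.card_bot, one_mul] at h1
    rw [← h1, ← Finset.sum_filter]
    have h2 : (Finset.univ.filter fun y => y - x ∈ H).card = Nat.card H := by
      rw [← card_filter_sub_mem H x]
      congr 1
      ext y
      rw [Finset.mem_filter, Finset.mem_filter, ← H.neg_mem_iff, neg_sub]
    rw [← h2, mul_comm, ← smul_eq_mul, ← Finset.sum_const]
    refine Finset.sum_le_sum fun y _ => ?_
    rw [cosetCount_bot]
    exact hmult y
  · intro K hK α
    obtain ⟨a, rfl⟩ := QuotientAddGroup.mk_surjective α
    rw [← card_quotient_comap_mk, Multiset.filter_map, Multiset.card_map]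
    convert hcoset _ (comap_mk_ne_top hK) a using 3
    rw [mem_coset_iff, Function.comp_apply, mem_coset_iff]
    rfl
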